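/- arXiv:2101.09481 — 6 statements merged into one kernel-verified Lean document; each statement's English description precedes it below -/
import Mathlib

section
/- Let d, N, j be positive integers with d ≥ 4, s = d−1 ≥ 2, j < N and d ≤ N, and let β ∈ ℕ satisfy 2β = d. Define f : ℝ^s → ℝ by f(α₁,…,α_s) = j − Σ_{l=1}^{s−1} l·αₗ − (s−β)·α_s. Then the minimum of f over the simplex Δ_{j,N,d} equals j − (s−β)·(N−j), and this minimum is attained exactly at the points of the line segment with endpoints (0,…,0,(N−j)/2,0) and (0,…,0,0,N−j); that is, f(α) equals the minimum if and only if α₁ = ⋯ = α_{s−2} = 0, α_{s−1} = λ·(N−j)/2 and α_s = (1−λ)·(N−j) for some λ ∈ [0,1]. -/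
/-- The simplex `Δ_{j,N,d} = {(α₁,…,α_s) ∈ ℝ₊^s : Σ_{l=1}^{s} (d−l)·αₗ ≤ N−j}`
(the coordinate `α l` represents `α_{l+1}`). -/
def Dset (s : ℕ) (j N d : ℝ) : Set (Fin s → ℝ) :=
  {α | (∀ l, 0 ≤ α l) ∧ ∑ l : Fin s, (d - ((l : ℝ) + 1)) * α l ≤ N - j}

theorem stmt_14 (d N j : ℕ) (hd : 4 ≤ d) (s : ℕ) (hs : s = d - 1) (hs2 : 2 ≤ s)
    (hjN : j < N) (hdN : d ≤ N) (hj : 1 ≤ j) (β : ℕ) (hβ : 2 * β = d)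
    (f : (Fin s → ℝ) → ℝ)
    (hf : ∀ α, f α = (j : ℝ) -
        ∑ l : Fin s, (if (l : ℕ) = s - 1 then ((s : ℝ) - β) else ((l : ℝ) + 1)) * α l) :
    IsLeast (f '' Dset s j N d) ((j : ℝ) - ((s : ℝ) - β) * ((N : ℝ) - j)) ∧
    (∀ α ∈ Dset s j N d,
      (f α = (j : ℝ) - ((s : ℝ) - β) * ((N : ℝ) - j) ↔
        (∀ l : Fin s, (l : ℕ) < s - 2 → α l = 0) ∧
        ∃ lam : ℝ, 0 ≤ lam ∧ lam ≤ 1 ∧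
          α ⟨s - 2, by omega⟩ = lam * ((N : ℝ) - j) / 2 ∧
          α ⟨s - 1, by omega⟩ = (1 - lam) * ((N : ℝ) - j))) := by
  obtain ⟨m, rfl⟩ : ∃ m, s = m + 2 := ⟨s - 2, by omega⟩
  have hd' : (d : ℝ) = m + 3 := by
    have : d = m + 3 := by omega
    rw [this]; push_cast; ring
  have hβ' : (β : ℝ) = (m + 3) / 2 := by
    have : (2 : ℝ) * β = d := by exact_mod_cast hβ
    linarith
  have hm1 : (1 : ℝ) ≤ m := by
    have : 1 ≤ m := by omega
    exact_mod_cast this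
  have hM : (0 : ℝ) < (N : ℝ) - j := by
    have : (j : ℝ) < N := by exact_mod_cast hjN
    linarith
  have i1 : (⟨m + 2 - 1, by omega⟩ : Fin (m + 2)) = Fin.last (m + 1) := by
    ext; simp
  have i2 : (⟨m + 2 - 2, by omega⟩ : Fin (m + 2)) = (Fin.last m).castSucc := by
    ext; simp
  rw [i1, i2]
  have hf' : ∀ α, f α = (j : ℝ) - (∑ i : Fin m, ((i : ℝ) + 1) * α i.castSucc.castSucc
      + ((m : ℝ) + 1) * α (Fin.last m).castSucc
      + (((m : ℝ) + 1) / 2) * α (Fin.last (m + 1))) := by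
    intro α
    rw [hf, Fin.sum_univ_castSucc, Fin.sum_univ_castSucc]
    have e : ∀ i : Fin m, ¬ ((i : ℕ) = m + 1) := fun i => by have := i.2; omega
    simp [e, hβ']
    left
    ring
  have hD : ∀ α, α ∈ Dset (m + 2) j N d ↔ (∀ l, 0 ≤ α l) ∧
      ∑ i : Fin m, ((m : ℝ) + 3 - ((i : ℝ) + 1)) * α i.castSucc.castSucc
      + 2 * α (Fin.last m).castSucc + α (Fin.last (m + 1)) ≤ (N : ℝ) - j := by
    intro α
    rw [Dset, Set.mem_setOf_eq, Fin.sum_univ_castSucc, Fin.sum_univ_castSucc, hd']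
    have e1 : (m : ℝ) + 3 - ((((Fin.last m).castSucc : Fin (m + 2)) : ℕ) + 1) = 2 := by
      simp; ring
    have e2 : (m : ℝ) + 3 - (((Fin.last (m + 1) : Fin (m + 2)) : ℕ) + 1) = 1 := by
      simp; ring
    rw [e1, e2, one_mul]
    simp
  have hgap : ∀ α : Fin (m + 2) → ℝ, ((m : ℝ) + 1) / 2 *
      ∑ i : Fin m, ((m : ℝ) + 3 - ((i : ℝ) + 1)) * α i.castSucc.castSucc
      - ∑ i : Fin m, ((i : ℝ) + 1) * α i.castSucc.castSucc
      = ∑ i : Fin m, ((m : ℝ) + 3) / 2 * ((m : ℝ) - i) * α i.castSucc.castSucc := by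
    intro α
    rw [Finset.mul_sum, ← Finset.sum_sub_distrib]
    refine Finset.sum_congr rfl fun i _ => ?_
    ring
  have hpos : ∀ i : Fin m, 0 < ((m : ℝ) + 3) / 2 * ((m : ℝ) - i) := by
    intro i
    have : (i : ℝ) < m := by exact_mod_cast i.2
    have : 0 < (m : ℝ) - i := by linarith
    positivity
  have hnn : ∀ α : Fin (m + 2) → ℝ, (∀ l, 0 ≤ α l) → ∀ i ∈ (Finset.univ : Finset (Fin m)),
      0 ≤ ((m : ℝ) + 3) / 2 * ((m : ℝ) - i) * α i.castSucc.castSucc :=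
    fun α h i _ => mul_nonneg (hpos i).le (h _)
  have hc : ((m + 2 : ℕ) : ℝ) - β = ((m : ℝ) + 1) / 2 := by
    rw [hβ']; push_cast; ring
  rw [hc]
  refine ⟨⟨?_, ?_⟩, ?_⟩
  · refine ⟨fun l => if l = Fin.last (m + 1) then (N : ℝ) - j else 0, ?_, ?_⟩
    · rw [hD]
      refine ⟨fun l => ?_, ?_⟩
      · split_ifs <;> linarith
      · simp [Fin.castSucc_ne_last]
    · rw [hf']
      simp [Fin.castSucc_ne_last]
  · rintro _ ⟨α, hα, rfl⟩
    rw [hD] at hα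
    obtain ⟨h0, h1⟩ := hα
    rw [hf']
    have h2 := Finset.sum_nonneg (hnn α h0)
    rw [← hgap] at h2
    have h3 := mul_le_mul_of_nonneg_left h1 (by positivity : (0 : ℝ) ≤ ((m : ℝ) + 1) / 2)
    linarith
  · intro α hα
    rw [hD] at hα
    obtain ⟨h0, h1⟩ := hα
    rw [hf']
    have h2 := Finset.sum_nonneg (hnn α h0)
    have h3 := mul_le_mul_of_nonneg_left h1 (by positivity : (0 : ℝ) ≤ ((m : ℝ) + 1) / 2)
    have hg := hgap α
    constructor
    · intro h
      have hz : ∑ i : Fin m, ((m : ℝ) + 3) / 2 * ((m : ℝ) - i) * α i.castSucc.castSucc = 0 := by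
        linarith
      rw [Finset.sum_eq_zero_iff_of_nonneg (hnn α h0)] at hz
      have hz' : ∀ i : Fin m, α i.castSucc.castSucc = 0 := fun i =>
        (mul_eq_zero.1 (hz i (Finset.mem_univ i))).resolve_left (hpos i).ne'
      simp only [hz', mul_zero, Finset.sum_const_zero, zero_add] at h h1
      have hx := h0 (Fin.last m).castSucc
      have hy := h0 (Fin.last (m + 1))
      have hsum : 2 * α (Fin.last m).castSucc + α (Fin.last (m + 1)) = (N : ℝ) - j := by
        have hcp : (0 : ℝ) < ((m : ℝ) + 1) / 2 := by positivity
        apply mul_left_cancel₀ hcp.ne'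
        linarith
      refine ⟨fun l hl => ?_, 2 * α (Fin.last m).castSucc / ((N : ℝ) - j), by positivity, ?_, ?_, ?_⟩
      · exact hz' ⟨l, by omega⟩
      · rw [div_le_one hM]; linarith
      · field_simp
      · field_simp; linarith
    · rintro ⟨hz, lam, -, -, hx, hy⟩
      have hz' : ∀ i : Fin m, α i.castSucc.castSucc = 0 := fun i => hz _ (by simp)
      simp only [hz', mul_zero, Finset.sum_const_zero, zero_add, hx, hy]
      ring
end

section
/- Let d₁ ≥ 2 be an integer, set d = 2d₁ and s = d−1, let k be a positive integer, set N = d₁·(2k+1), and let j be an integer with 1 ≤ j < N. Then the minimum of α₀ + d₁·α_s over all tuples (α₀,…,α_s) ∈ Z_{j,N,d} equals d₁·j − (d₁−1)·N, and this minimum is attained exactly at the points (d·j − s·N + d·l, 0, …, 0, l, N−j−2l) (with l in coordinate s−1 and N−j−2l in coordinate s) for integers l with 0 ≤ 2l ≤ N−j. -/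
/-- The set `Z_{j,N,d}` of multi-indices `(α₀,α₁,…,α_s) ∈ ℤ × ℕ^s` (here `s = d-1`,
and `α.2 l` represents `α_{l+1}`) with `α₀ + α₁ + 2α₂ + ⋯ + sα_s = j` and
`α₀ + d(α₁ + ⋯ + α_s) ≤ N`. -/
def Zset (s : ℕ) (j N d : ℤ) : Set (ℤ × (Fin s → ℕ)) :=
  {α | α.1 + ∑ l : Fin s, ((l : ℤ) + 1) * (α.2 l : ℤ) = j ∧
       α.1 + d * ∑ l : Fin s, (α.2 l : ℤ) ≤ N}

theorem stmt_15 (d₁ : ℕ) (hd₁ : 2 ≤ d₁) (d s : ℕ) (hd : d = 2 * d₁)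
    (hs : s = d - 1) (k : ℕ) (hk : 1 ≤ k) (N : ℕ) (hN : N = d₁ * (2 * k + 1))
    (j : ℕ) (hj : 1 ≤ j) (hjN : j < N)
    (pt : ℕ → ℤ × (Fin s → ℕ))
    (hpt : ∀ l : ℕ, pt l = ((d : ℤ) * j - s * N + d * l,
        fun m : Fin s => if (m : ℕ) = s - 2 then l
          else if (m : ℕ) = s - 1 then N - j - 2 * l else 0)) :
    (∀ α ∈ Zset s j N d,
        (d₁ : ℤ) * j - (d₁ - 1) * N ≤ α.1 + d₁ * α.2 ⟨s - 1, by omega⟩) ∧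
    (∀ l : ℕ, 2 * l ≤ N - j →
        pt l ∈ Zset s j N d ∧
        (pt l).1 + d₁ * (pt l).2 ⟨s - 1, by omega⟩ = (d₁ : ℤ) * j - (d₁ - 1) * N) ∧
    (∀ α ∈ Zset s j N d,
        α.1 + d₁ * α.2 ⟨s - 1, by omega⟩ = (d₁ : ℤ) * j - (d₁ - 1) * N →
        ∃ l : ℕ, 2 * l ≤ N - j ∧ α = pt l) := by
  obtain ⟨e, rfl⟩ : ∃ e, d₁ = e + 2 := ⟨d₁ - 2, by omega⟩
  obtain ⟨n, hn, rfl⟩ : ∃ n, n = 2 * e + 1 ∧ s = n + 2 := ⟨2 * e + 1, rfl, by omega⟩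
  obtain ⟨r, hr, rfl⟩ : ∃ r, 1 ≤ r ∧ N = j + r := ⟨N - j, by omega, by omega⟩
  have hnz : (n : ℤ) = 2 * e + 1 := by exact_mod_cast hn
  have hdz : (d : ℤ) = 2 * e + 4 := by rw [hd]; push_cast; ring
  have hlast : (⟨n + 2 - 1, by omega⟩ : Fin (n + 2)) = Fin.last (n + 1) := by
    ext; simp
  have hB : ∀ f : Fin (n + 2) → ℕ,
      ∑ l : Fin n, (((l : ℕ) : ℤ) + 1) * (f l.castSucc.castSucc : ℤ)
        ≤ n * ∑ l : Fin n, (f l.castSucc.castSucc : ℤ) := by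
    intro f
    rw [Finset.mul_sum]
    refine Finset.sum_le_sum fun l _ => ?_
    have := l.2
    exact mul_le_mul_of_nonneg_right (by omega) (by positivity)
  have hA : ∀ f : Fin (n + 2) → ℕ, 0 ≤ ∑ l : Fin n, (f l.castSucc.castSucc : ℤ) :=
    fun f => by positivity
  have he : (0 : ℤ) ≤ e := by positivity
  refine ⟨?_, ?_, ?_⟩
  · rintro ⟨a, f⟩ ⟨h1, h2⟩
    have hB' := hB f
    have hA' := hA f
    simp only [Fin.sum_univ_castSucc, Fin.val_castSucc, Fin.val_last, hlast] at h1 h2 ⊢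
    generalize ∑ l : Fin n, (((l : ℕ) : ℤ) + 1) * (f l.castSucc.castSucc : ℤ) = B at *
    generalize ∑ l : Fin n, (f l.castSucc.castSucc : ℤ) = A at *
    push_cast at h1 h2 ⊢
    rw [hnz] at h1 hB'
    rw [hdz] at h2
    nlinarith [mul_le_mul_of_nonneg_left h2 (by linarith : (0:ℤ) ≤ e + 1),
      mul_le_mul_of_nonneg_left hB' (by linarith : (0:ℤ) ≤ e + 2),
      mul_nonneg he hA']
  · intro l hl
    have hl' : 2 * l ≤ r := by omega
    rw [hpt]
    have hz : ∀ x : Fin n, ((x : ℕ) = n) = False := fun x => by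
      have := x.2; simp; omega
    have hz1 : ∀ x : Fin n, ((x : ℕ) = n + 1) = False := fun x => by
      have := x.2; simp; omega
    have hc : ((j + r - j - 2 * l : ℕ) : ℤ) = r - 2 * l := by omega
    refine ⟨⟨?_, ?_⟩, ?_⟩
    · simp [Fin.sum_univ_castSucc, hz, hz1, -Nat.cast_sub] 
      try rw [Nat.cast_sub hl']
      push_cast
      rw [hnz, hdz]; ring
    · simp [Fin.sum_univ_castSucc, hz, hz1] 
      try rw [Nat.cast_sub hl']
      push_cast
      rw [hnz, hdz]; apply le_of_eq; ring
    · simp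
      try rw [Nat.cast_sub hl']
      push_cast
      rw [hnz, hdz]; ring
  · rintro ⟨a, f⟩ ⟨h1, h2⟩ h3
    have hB' := hB f
    have hA' := hA f
    simp only [Fin.sum_univ_castSucc, Fin.val_castSucc, Fin.val_last, hlast] at h1 h2 h3
    have hA0 : ∑ l : Fin n, (f l.castSucc.castSucc : ℤ) = 0 := by
      generalize ∑ l : Fin n, (((l : ℕ) : ℤ) + 1) * (f l.castSucc.castSucc : ℤ) = B at *
      generalize ∑ l : Fin n, (f l.castSucc.castSucc : ℤ) = A at *
      push_cast at h1 h2 h3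
      rw [hnz] at h1 hB'
      rw [hdz] at h2
      nlinarith [mul_le_mul_of_nonneg_left h2 (by linarith : (0:ℤ) ≤ e + 1),
        mul_le_mul_of_nonneg_left hB' (by linarith : (0:ℤ) ≤ e + 2),
        mul_nonneg he hA']
    have hf0 : ∀ l : Fin n, f l.castSucc.castSucc = 0 := by
      intro l
      have := (Finset.sum_eq_zero_iff_of_nonneg (fun i _ => by positivity)).1 hA0 l
        (Finset.mem_univ l)
      exact_mod_cast this
    simp only [hf0] at h1 h2
    push_cast at h1 h2 h3
    simp only [mul_zero, Finset.sum_const_zero, zero_add] at h1 h2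
    rw [hnz] at h1
    rw [hdz] at h2
    set u := f (Fin.last n).castSucc with hu
    set v := f (Fin.last (n + 1)) with hv
    have key : (2 * u + v : ℤ) = r := by
      have : ((e : ℤ) + 1) * (2 * u + v - r) = 0 := by linear_combination h1 - h3
      rcases mul_eq_zero.1 this with h | h <;> linarith
    have key' : 2 * u + v = r := by exact_mod_cast key
    refine ⟨u, by omega, ?_⟩
    rw [hpt]
    refine Prod.ext ?_ ?_
    · simp only
      push_cast
      rw [hnz, hdz]
      linear_combination h1 - (2 * e + 3) * key
    · funext m
      simp only
      refine Fin.lastCases ?_ (fun m => ?_) m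
      · simp; omega
      · refine Fin.lastCases ?_ (fun m => ?_) m
        · simp [hu]
        · have := m.2
          rw [hf0, if_neg (by simp; omega), if_neg (by simp; omega)]
end

section
/- Let d₁ ≥ 2 be an integer, set d = 2d₁ and s = d−1, let k be a positive integer, set N = d₁·(2k+1), let t be a positive integer dividing d₁, and set r = d/t and r̃ = d₁/t. Let j be an integer with 1 ≤ j < N. Then the minimum of α₀ + r̃·α_s over all tuples (α₀,…,α_s) ∈ Z^{(t)}_{j,N,d} equals r̃·j − (d₁−1)·(2k+1)·r̃, and this minimum is attained exactly at the points (r·j − s·r̃·(2k+1) + r·l, 0, …, 0, l, N−j−2l) (with l in coordinate s−1 and N−j−2l in coordinate s) for integers l with 0 ≤ 2l ≤ N−j. -/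
/-- The set `Z^{(t)}_{j,N,d}` of multi-indices `(α₀,α₁,…,α_s) ∈ ℤ × ℕ^s` (here `s = d-1`,
and `α.2 l` represents `α_{l+1}`) with `tα₀ + α₁ + 2α₂ + ⋯ + sα_s = j` and
`tα₀ + d(α₁ + ⋯ + α_s) ≤ N`. -/
def ZsetT (s : ℕ) (j N d t : ℤ) : Set (ℤ × (Fin s → ℕ)) :=
  {α | t * α.1 + ∑ l : Fin s, ((l : ℤ) + 1) * (α.2 l : ℤ) = j ∧
       t * α.1 + d * ∑ l : Fin s, (α.2 l : ℤ) ≤ N}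

theorem stmt_16 (d₁ : ℕ) (hd₁ : 2 ≤ d₁) (d s : ℕ) (hd : d = 2 * d₁)
    (hs : s = d - 1) (k : ℕ) (hk : 1 ≤ k) (N : ℕ) (hN : N = d₁ * (2 * k + 1))
    (t : ℕ) (ht : 0 < t) (htd : t ∣ d₁) (r rt : ℕ) (hr : r = d / t) (hrt : rt = d₁ / t)
    (j : ℕ) (hj : 1 ≤ j) (hjN : j < N)
    (pt : ℕ → ℤ × (Fin s → ℕ))
    (hpt : ∀ l : ℕ, pt l = ((r : ℤ) * j - s * rt * (2 * k + 1) + r * l,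
        fun m : Fin s => if (m : ℕ) = s - 2 then l
          else if (m : ℕ) = s - 1 then N - j - 2 * l else 0)) :
    (∀ α ∈ ZsetT s j N d t,
        (rt : ℤ) * j - (d₁ - 1) * (2 * k + 1) * rt
          ≤ α.1 + rt * α.2 ⟨s - 1, by omega⟩) ∧
    (∀ l : ℕ, 2 * l ≤ N - j →
        pt l ∈ ZsetT s j N d t ∧
        (pt l).1 + rt * (pt l).2 ⟨s - 1, by omega⟩
          = (rt : ℤ) * j - (d₁ - 1) * (2 * k + 1) * rt) ∧
    (∀ α ∈ ZsetT s j N d t,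
        α.1 + rt * α.2 ⟨s - 1, by omega⟩
            = (rt : ℤ) * j - (d₁ - 1) * (2 * k + 1) * rt →
        ∃ l : ℕ, 2 * l ≤ N - j ∧ α = pt l) := by
  obtain ⟨q, hq⟩ := htd
  have hrt' : rt = q := by rw [hrt, hq]; exact Nat.mul_div_cancel_left q ht
  have hr' : r = 2 * q := by
    rw [hr, hd, hq, show 2 * (t * q) = t * (2 * q) by ring]
    exact Nat.mul_div_cancel_left _ ht
  clear hr hrt
  subst hrt' hr'
  obtain ⟨n, rfl⟩ : ∃ n, s = n + 2 := ⟨s - 2, by omega⟩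
  have hn : (n : ℤ) = 2 * d₁ - 3 := by omega
  have hdz : (d : ℤ) = 2 * d₁ := by omega
  have hqz : (d₁ : ℤ) = t * rt := by exact_mod_cast hq
  have hNz : (N : ℤ) = d₁ * (2 * k + 1) := by exact_mod_cast hN
  have htz : (0 : ℤ) < t := by exact_mod_cast ht
  have hd1z : (2 : ℤ) ≤ d₁ := by exact_mod_cast hd₁
  have hlast : (⟨n + 2 - 1, by omega⟩ : Fin (n + 2)) = Fin.last (n + 1) := rfl
  -- the key identity for points of the set
  have key : ∀ α ∈ ZsetT (n + 2) j N d t, ∃ D S W : ℤ, 0 ≤ D ∧ 0 ≤ S ∧ S ≤ W ∧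
      S = ∑ i : Fin n, (α.2 i.castSucc.castSucc : ℤ) ∧
      (S = 0 → t * α.1 + (n + 1) * α.2 (Fin.last n).castSucc
        + (n + 2) * α.2 (Fin.last (n + 1)) = j ∧
        D = N - j - 2 * α.2 (Fin.last n).castSucc - α.2 (Fin.last (n + 1))) ∧
      t * (α.1 + rt * α.2 (Fin.last (n + 1)) -
        ((rt : ℤ) * j - (d₁ - 1) * (2 * k + 1) * rt)) = d₁ * W + (d₁ - 1) * D := by
    rintro ⟨a, f⟩ ⟨h1, h2⟩
    simp only [Fin.sum_univ_castSucc, Fin.val_castSucc, Fin.val_last] at h1 h2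
    push_cast at h1
    have hS0 : (0 : ℤ) ≤ ∑ i : Fin n, (f i.castSucc.castSucc : ℤ) :=
      Finset.sum_nonneg fun i _ => by positivity
    have hW : ∑ i : Fin n, ((i : ℤ) + 1) * (f i.castSucc.castSucc : ℤ)
        ≤ n * ∑ i : Fin n, (f i.castSucc.castSucc : ℤ) := by
      rw [Finset.mul_sum]
      refine Finset.sum_le_sum fun i _ => ?_
      have : (i : ℤ) + 1 ≤ n := by have := i.2; omega
      gcongr
    have hB0 : (∑ i : Fin n, (f i.castSucc.castSucc : ℤ)) = 0 →
        ∑ i : Fin n, ((i : ℤ) + 1) * (f i.castSucc.castSucc : ℤ) = 0 := by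
      intro h
      refine le_antisymm (by rw [h] at hW; linarith) (Finset.sum_nonneg fun i _ => by positivity)
    dsimp only
    generalize hSe : (∑ i : Fin n, (f i.castSucc.castSucc : ℤ)) = S at *
    generalize (∑ i : Fin n, ((i : ℤ) + 1) * (f i.castSucc.castSucc : ℤ)) = B at *
    generalize (f (Fin.last n).castSucc : ℤ) = P at *
    generalize (f (Fin.last (n + 1)) : ℤ) = Q at *
    refine ⟨N - (t * a + d * (S + P + Q)), S, (n + 1) * S - B, by linarith, hS0, by linarith,
      rfl, ?_, ?_⟩
    · intro h
      have hB := hB0 h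
      subst h hB
      refine ⟨by linarith, ?_⟩
      rw [← h1, hdz, hn]; ring
    · rw [hNz, ← h1, hdz, hn, hqz]; ring
  refine ⟨?_, ?_, ?_⟩
  · intro α hα
    obtain ⟨D, S, W, hD, hS, hSW, -, -, h⟩ := key α hα
    rw [hlast]
    have : 0 ≤ d₁ * W + (d₁ - 1) * D :=
      add_nonneg (mul_nonneg (by linarith) (by linarith)) (mul_nonneg (by linarith) hD)
    rw [← h] at this
    have := nonneg_of_mul_nonneg_right this htz
    linarith
  · intro l hl
    have hcast : ((N - j - 2 * l : ℕ) : ℤ) = N - j - 2 * l := by omega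
    rw [hpt l, hlast]
    refine ⟨⟨?_, ?_⟩, ?_⟩
    · have hz : ∀ i : Fin n, (i : ℕ) ≠ n ∧ (i : ℕ) ≠ n + 1 := fun i => by
        have := i.2; omega
      simp only [Fin.sum_univ_castSucc, Fin.val_castSucc, Fin.val_last]
      simp [hz, hcast]
      rw [hNz, hn, hqz]; ring
    · have hz : ∀ i : Fin n, (i : ℕ) ≠ n ∧ (i : ℕ) ≠ n + 1 := fun i => by
        have := i.2; omega
      simp only [Fin.sum_univ_castSucc, Fin.val_castSucc, Fin.val_last]
      simp [hz, hcast]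
      apply le_of_eq
      rw [hdz, hNz, hn, hqz]; ring
    · simp [hcast]
      rw [hNz, hn, hqz]; ring
  · intro α hα heq
    obtain ⟨D, S, W, hD, hS, hSW, hSe, h0, h⟩ := key α hα
    rw [hlast] at heq
    rw [heq, sub_self, mul_zero] at h
    have hW0 : 0 ≤ d₁ * W := mul_nonneg (by linarith) (by linarith)
    have hD0 : 0 ≤ ((d₁ : ℤ) - 1) * D := mul_nonneg (by linarith) hD
    have hW' : W = 0 := by
      have : (d₁ : ℤ) * W = 0 := by linarith
      rcases mul_eq_zero.1 this with h | h
      · omega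
      · exact h
    have hD' : D = 0 := by
      have : ((d₁ : ℤ) - 1) * D = 0 := by linarith
      rcases mul_eq_zero.1 this with h | h
      · omega
      · exact h
    have hS' : S = 0 := by omega
    obtain ⟨e1, e2⟩ := h0 hS'
    rw [hS'] at hSe
    have hall := (Finset.sum_eq_zero_iff_of_nonneg (fun i _ => by positivity)).1 hSe.symm
    obtain ⟨a, f⟩ := α
    dsimp only at *
    refine ⟨f (Fin.last n).castSucc, by omega, ?_⟩
    rw [hpt]
    refine Prod.ext ?_ ?_
    · dsimp only
      apply mul_left_cancel₀ htz.ne'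
      have hQ : (f (Fin.last (n + 1)) : ℤ) = N - j - 2 * f (Fin.last n).castSucc := by linarith
      rw [hQ] at e1
      have e3 : t * a = j - (n + 1) * f (Fin.last n).castSucc
        - (n + 2) * (N - j - 2 * f (Fin.last n).castSucc) := by linarith
      rw [e3]
      push_cast
      rw [hNz, hn, hqz]; ring
    · funext m
      dsimp only
      refine Fin.lastCases ?_ (fun m => ?_) m
      · simp; omega
      · refine Fin.lastCases ?_ (fun i => ?_) m
        · simp
        · have := i.2
          have h3 := hall i (Finset.mem_univ _)
          have h4 : (i : ℕ) ≠ n := by omega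
          have h5 : (i : ℕ) ≠ n + 1 := by omega
          simp [h4, h5]
          exact_mod_cast h3
end

section
/- Let d₁ ≥ 2 be an integer, set d = 2d₁, and let k be a positive integer. Then for every l ∈ {0,1,…,k+1} the identity (∏_{i=1}^{2k+2−l}(−2d₁k − 3d₁ + 2d₁l + 2d₁·i)) / ((∏_{p=1}^{l} 2d₁·p)·(∏_{q=1}^{2k+2−2l} 2d₁·q)) = (−4)^l · binom(k+1, l) · (∏_{i=1}^{2k+2}(−2d₁k − 3d₁ + 2d₁·i)) / (∏_{q=1}^{2k+2} 2d₁·q) holds in ℚ. Equivalently, with s = 2d₁−1, N = 2d₁k + d₁ and any a_N ∈ ℂ, the coefficients c_α = (∏_{m=1}^{α₁+⋯+α_s}(α₀ + d·m)) / (∏_{l'=1}^{s} ∏_{i=1}^{α_{l'}} d·i) · a_N satisfy c at the multi-index (−2d₁k−3d₁+2d₁l, 0, …, 0, l, 2k+2−2l) (with l in coordinate s−1 and 2k+2−2l in coordinate s) equals (−4)^l · binom(k+1, l) times c at the multi-index (−2d₁k−3d₁, 0, …, 0, 0, 2k+2), for all l ∈ {0,1,…,k+1}. -/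
theorem aux_bot (g : ℕ → ℚ) (m : ℕ) :
    ∏ i ∈ Finset.Icc 1 (m + 1), g i = g 1 * ∏ i ∈ Finset.Icc 1 m, g (i + 1) := by
  induction m with
  | zero => simp
  | succ m ih =>
    rw [Finset.prod_Icc_succ_top (by omega), ih, Finset.prod_Icc_succ_top (by omega), mul_assoc]

theorem stmt_17 (d₁ : ℕ) (hd₁ : 2 ≤ d₁) (d : ℕ) (hd : d = 2 * d₁)
    (k : ℕ) (hk : 1 ≤ k) :
    ∀ l : ℕ, l ≤ k + 1 →
      (∏ i ∈ Finset.Icc 1 (2 * k + 2 - l),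
          ((-2 : ℚ) * d₁ * k - 3 * d₁ + 2 * d₁ * l + 2 * d₁ * i)) /
        ((∏ p ∈ Finset.Icc 1 l, ((2 : ℚ) * d₁ * p)) *
          ∏ q ∈ Finset.Icc 1 (2 * k + 2 - 2 * l), ((2 : ℚ) * d₁ * q)) =
      (-4 : ℚ) ^ l * (Nat.choose (k + 1) l) *
        ((∏ i ∈ Finset.Icc 1 (2 * k + 2),
            ((-2 : ℚ) * d₁ * k - 3 * d₁ + 2 * d₁ * i)) /
          ∏ q ∈ Finset.Icc 1 (2 * k + 2), ((2 : ℚ) * d₁ * q)) := by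
  intro l
  have hd0 : (d₁ : ℚ) ≠ 0 := by
    have : d₁ ≠ 0 := by omega
    exact_mod_cast this
  have hpos : ∀ m : ℕ, (∏ q ∈ Finset.Icc 1 m, ((2 : ℚ) * d₁ * q)) ≠ 0 := by
    intro m
    refine Finset.prod_ne_zero_iff.mpr ?_
    intro q hq
    have hq1 := (Finset.mem_Icc.mp hq).1
    have : (q : ℚ) ≠ 0 := by
      have : q ≠ 0 := by omega
      exact_mod_cast this
    positivity
  induction l with
  | zero => intro _; simp
  | succ l ih =>
    intro hl
    have ih := ih (by omega)
    obtain ⟨n, rfl⟩ : ∃ n, k = l + n := ⟨k - l, by omega⟩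
    have e1 : 2 * (l + n) + 2 - l = (l + 2 * n + 1) + 1 := by omega
    have e2 : 2 * (l + n) + 2 - 2 * l = (2 * n + 1) + 1 := by omega
    have e3 : 2 * (l + n) + 2 - (l + 1) = l + 2 * n + 1 := by omega
    have e4 : 2 * (l + n) + 2 - 2 * (l + 1) = 2 * n := by omega
    rw [e1, e2, aux_bot, Finset.prod_Icc_succ_top (b := 2 * n + 1) (by omega),
      Finset.prod_Icc_succ_top (b := 2 * n) (by omega)] at ih
    rw [e3, e4, Finset.prod_Icc_succ_top (b := l) (by omega)]
    have hch : ((l + n + 1).choose (l + 1) : ℚ) = (l + n + 1).choose l * (n + 1) / (l + 1) := by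
      have h := Nat.choose_succ_right_eq (l + n + 1) l
      have e5 : l + n + 1 - l = n + 1 := by omega
      rw [e5] at h
      have h' : ((l + n + 1).choose (l + 1) : ℚ) * (l + 1) = (l + n + 1).choose l * (n + 1) := by
        exact_mod_cast h
      rw [← h']
      field_simp
    have hprod : ∏ i ∈ Finset.Icc 1 (l + 2 * n + 1),
          ((-2 : ℚ) * d₁ * (l + n : ℕ) - 3 * d₁ + 2 * d₁ * (l + 1 : ℕ) + 2 * d₁ * i) =
        ∏ i ∈ Finset.Icc 1 (l + 2 * n + 1),
          ((-2 : ℚ) * d₁ * (l + n : ℕ) - 3 * d₁ + 2 * d₁ * l + 2 * d₁ * (i + 1 : ℕ)) := by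
      refine Finset.prod_congr rfl fun i _ => ?_
      push_cast
      ring
    rw [hprod, hch, pow_succ]
    generalize (∏ i ∈ Finset.Icc 1 (l + 2 * n + 1),
          ((-2 : ℚ) * d₁ * (l + n : ℕ) - 3 * d₁ + 2 * d₁ * l + 2 * d₁ * (i + 1 : ℕ))) = A at *
    have hB := hpos l
    have hC := hpos (2 * n)
    generalize (∏ q ∈ Finset.Icc 1 l, ((2 : ℚ) * d₁ * q)) = B at *
    generalize (∏ q ∈ Finset.Icc 1 (2 * n), ((2 : ℚ) * d₁ * q)) = C at *
    generalize ((∏ i ∈ Finset.Icc 1 (2 * (l + n) + 2),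
            ((-2 : ℚ) * d₁ * (l + n : ℕ) - 3 * d₁ + 2 * d₁ * i)) /
          ∏ q ∈ Finset.Icc 1 (2 * (l + n) + 2), ((2 : ℚ) * d₁ * q)) = R at *
    have hn1 : (n : ℚ) + 1 ≠ 0 := by positivity
    have hn2 : 2 * (n : ℚ) + 1 ≠ 0 := by positivity
    have hl1 : (l : ℚ) + 1 ≠ 0 := by positivity
    trans (-4) * ((n + 1) / (l + 1)) * ((-4 : ℚ) ^ l * ((l + n + 1).choose l) * R)
    · rw [← ih]
      push_cast
      have hn3 : 2 * (n : ℚ) + 1 + 1 ≠ 0 := by positivity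
      field_simp
      ring
    · ring
end

section
/- Let d₁ ≥ 2 be an integer, set d = 2d₁ and s = d−1, let k be a positive integer, and set N = 2d₁k + d₁. Assume the setup with deg h = 1 (so F_d = h^d and G_N = a_N·h^N) and assume deg[F,G] < d + N − 2k − 2. Then there exist homogeneous polynomials F̃ of degree d₁ − 1 and F̂ of degree s − 2 such that F_s = h^{d₁}·F̃ and F_{s−1} = (1/4)·(F̃² + h·F̂). -/
section
open MvPolynomial

/-- `deg [f,g] < B`, where `deg [f,g] = 2 + max` of the total degrees of the Jacobian
minors (with the convention `deg 0 = -∞`). -/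
def PoissonDegLT {n : ℕ} (f g : MvPolynomial (Fin n) ℂ) (B : ℤ) : Prop :=
  ∀ p q : Fin n,
    pderiv p f * pderiv q g - pderiv q f * pderiv p g = 0 ∨
    ((pderiv p f * pderiv q g - pderiv q f * pderiv p g).totalDegree : ℤ) + 2 < B

end

namespace Aux18
open Polynomial

lemma aux_xd_coeff (p : ℂ[X]) (n : ℕ) : (X * derivative p).coeff n = n * p.coeff n := by
  cases n with
  | zero => simp
  | succ n => rw [coeff_X_mul, coeff_derivative]; push_cast; ring

lemma aux_xd_deg (p : ℂ[X]) (n : ℕ) : (X * derivative p).natDegree ≤ n ↔ p.natDegree ≤ n := by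
  rw [natDegree_le_iff_coeff_eq_zero, natDegree_le_iff_coeff_eq_zero]
  refine forall_congr' fun l => forall_congr' fun hl => ?_
  rw [aux_xd_coeff]
  have : (l : ℂ) ≠ 0 := by exact_mod_cast (by omega : l ≠ 0)
  simp [this]

/-- relation at order `j`, multiplied by `X`. -/
noncomputable def relT (d N : ℕ) (f g : ℕ → ℂ[X]) (j i : ℕ) : ℂ[X] :=
  C ((d : ℂ) - i) * (f i * (X * derivative (g (j - i)))) -
   C ((N : ℂ) - (j - i : ℕ)) * ((X * derivative (f i)) * g (j - i))

lemma relT_deg (d N : ℕ) (f g : ℕ → ℂ[X]) (m j i : ℕ) (hi : i ≤ j)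
    (hf : (f i).natDegree ≤ m * i) (hg : (g (j - i)).natDegree ≤ m * (j - i)) :
    (relT d N f g j i).natDegree ≤ m * j := by
  have e : m * j = m * i + m * (j - i) := by rw [← mul_add]; congr 1; omega
  rw [e]
  unfold relT
  refine (natDegree_sub_le _ _).trans (max_le ?_ ?_)
  · exact (natDegree_C_mul_le _ _).trans (natDegree_mul_le_of_le hf ((aux_xd_deg _ _).2 hg))
  · exact (natDegree_C_mul_le _ _).trans (natDegree_mul_le_of_le ((aux_xd_deg _ _).2 hf) hg)

lemma relT_coeff (d N : ℕ) (f g : ℕ → ℂ[X]) (m j i : ℕ) (hi : i ≤ j)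
    (hf : (f i).natDegree ≤ m * i) (hg : (g (j - i)).natDegree ≤ m * (j - i)) :
    (relT d N f g j i).coeff (m * j) = 
      m * (((d : ℂ) * (j - i : ℕ) - N * i) * (f i).coeff (m * i) * (g (j - i)).coeff (m * (j - i))) := by
  have e : m * j = m * i + m * (j - i) := by rw [← mul_add]; congr 1; omega
  rw [e]
  unfold relT
  rw [coeff_sub, coeff_C_mul, coeff_C_mul,
    coeff_mul_add_eq_of_natDegree_le hf ((aux_xd_deg _ _).2 hg),
    coeff_mul_add_eq_of_natDegree_le ((aux_xd_deg _ _).2 hf) hg, aux_xd_coeff, aux_xd_coeff]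
  push_cast
  ring

lemma core_deg (d N M m : ℕ) (hd : d ≠ 0) (f g : ℕ → ℂ[X]) (a : ℂ)
    (hf0 : f 0 = 1) (hg0 : g 0 = C a)
    (hrel : ∀ j ≤ M, ∑ i ∈ Finset.range (j + 1), relT d N f g j i = 0)
    (hf : ∀ i, (f i).natDegree ≤ m * i) : ∀ j ≤ M, (g j).natDegree ≤ m * j := by
  intro j
  induction j using Nat.strong_induction_on with
  | _ j ih =>
  intro hj
  rcases Nat.eq_zero_or_pos j with rfl | hpos
  · simp [hg0]
  have h := hrel j hj
  rw [Finset.sum_range_succ'] at h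
  have h0 : relT d N f g j 0 = C (d : ℂ) * (X * derivative (g j)) := by
    simp [relT, hf0]
  rw [h0] at h
  have h1 : C (d : ℂ) * (X * derivative (g j)) =
      - ∑ i ∈ Finset.range j, relT d N f g j (i + 1) := by linear_combination h
  have hd' : (d : ℂ) ≠ 0 := by exact_mod_cast hd
  rw [← aux_xd_deg, ← natDegree_C_mul hd', h1, natDegree_neg]
  refine natDegree_sum_le_of_forall_le _ _ fun i hi => ?_
  rw [Finset.mem_range] at hi
  exact relT_deg _ _ _ _ _ _ _ (by omega) (hf _) (ih _ (by omega) (by omega))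

lemma core_rec (d N M m : ℕ) (hd : d ≠ 0) (hm : m ≠ 0) (f g : ℕ → ℂ[X]) (a : ℂ)
    (hf0 : f 0 = 1) (hg0 : g 0 = C a)
    (hrel : ∀ j ≤ M, ∑ i ∈ Finset.range (j + 1), relT d N f g j i = 0)
    (hf : ∀ i, (f i).natDegree ≤ m * i) : ∀ j ≤ M, 
    ∑ i ∈ Finset.range (j + 1), ((d : ℂ) * (j - i : ℕ) - N * i) * (f i).coeff (m * i) * 
      (g (j - i)).coeff (m * (j - i)) = 0 := by
  intro j hj
  have hg := core_deg d N M m hd f g a hf0 hg0 hrel hf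
  have h := congrArg (fun p => p.coeff (m * j)) (hrel j hj)
  simp only [finsetSum_coeff, coeff_zero] at h
  have hm' : (m : ℂ) ≠ 0 := by exact_mod_cast hm
  apply mul_left_cancel₀ hm'
  rw [mul_zero, Finset.mul_sum, ← h]
  refine Finset.sum_congr rfl fun i hi => ?_
  rw [Finset.mem_range] at hi
  rw [relT_coeff _ _ _ _ _ _ _ (by omega) (hf _) (hg _ (by omega))]

/-- First conclusion. -/
lemma core_one (d₁ k : ℕ) (hd₁ : 2 ≤ d₁) (f g : ℕ → ℂ[X]) (a : ℂ) (ha : a ≠ 0)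
    (hf0 : f 0 = 1) (hg0 : g 0 = C a)
    (hrel : ∀ j ≤ 2 * k + 2, ∑ i ∈ Finset.range (j + 1),
      relT (2 * d₁) (2 * d₁ * k + d₁) f g j i = 0)
    (hf : ∀ i, (f i).natDegree ≤ 2 * d₁ - i)
    (hg : ∀ i, (g i).natDegree ≤ 2 * d₁ * k + d₁ - i) : (f 1).natDegree ≤ d₁ - 1 := by
  by_contra hcon
  set m := (f 1).natDegree with hmdef
  have hmd : d₁ ≤ m := by omega
  have hj2 : ∀ i, 2 ≤ i → 2 * d₁ - i < m * i := fun i hi => by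
    have : d₁ * 2 ≤ m * i := Nat.mul_le_mul hmd hi
    omega
  have hfm : ∀ i, (f i).natDegree ≤ m * i := by
    intro i
    rcases i with _ | _ | i
    · simp [hf0]
    · simp [hmdef]
    · exact (hf _).trans (hj2 _ (by omega)).le
  have hrec := core_rec (2 * d₁) _ (2 * k + 2) m (by omega) (by omega) f g a hf0 hg0 hrel hfm
  have hb : (f 1).coeff (m * 1) ≠ 0 := by
    rw [mul_one, hmdef, coeff_natDegree, leadingCoeff_ne_zero]
    rintro h0
    simp [h0] at hmdef
    omega
  have hfz : ∀ i, 2 ≤ i → (f i).coeff (m * i) = 0 := fun i hi =>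
    coeff_eq_zero_of_natDegree_lt ((hf i).trans_lt (hj2 i hi))
  have hne : ∀ j, j ≤ 2 * k + 1 → (g j).coeff (m * j) ≠ 0 := by
    intro j
    induction j with
    | zero => intro _; simpa [hg0] using ha
    | succ j ih =>
      intro hj h0
      have h := hrec (j + 1) (by omega)
      rw [Finset.sum_range_succ', Finset.sum_range_succ'] at h
      rw [Finset.sum_eq_zero (fun i _ => by rw [hfz _ (by omega)]; ring)] at h
      simp only [zero_add, Nat.sub_zero, h0, mul_zero, add_zero, Nat.add_sub_cancel] at h
      have h3 := ih (by omega)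
      have h4 := (mul_eq_zero.1 ((mul_eq_zero.1 h).resolve_right h3)).resolve_right hb
      have h5 : ((2 * d₁ : ℕ) : ℤ) * (j : ℤ) - ((2 * d₁ * k + d₁ : ℕ) : ℤ) * ((1 : ℕ) : ℤ) = 0 := by
        exact_mod_cast h4
      push_cast at h5
      have h6 : (d₁ : ℤ) * (2 * j - 2 * k - 1) = 0 := by linear_combination h5
      rcases mul_eq_zero.1 h6 with h7 | h7 <;> omega
  apply hne _ le_rfl
  apply coeff_eq_zero_of_natDegree_lt
  refine (hg _).trans_lt ?_
  have : d₁ * (2 * k + 1) ≤ m * (2 * k + 1) := Nat.mul_le_mul_right _ hmd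
  have e : d₁ * (2 * k + 1) = 2 * d₁ * k + d₁ := by ring
  have : 0 < d₁ * (2 * k + 1) := by positivity
  omega

/-- A polynomial solution of the ODE forces an even multiplicity. -/
lemma ode_poly (p q : ℂ[X]) (k : ℕ) (hq : q ≠ 0)
    (h : C 2 * (p * derivative q) = C ((2 * k + 1 : ℕ) : ℂ) * (derivative p * q)) (r : ℂ)
    (hr : p.eval r = 0) : (derivative p).eval r = 0 := by
  obtain ⟨p₁, rfl⟩ := dvd_iff_isRoot.2 hr
  obtain ⟨q₁, hq₁, hnd⟩ := exists_eq_pow_rootMultiplicity_mul_and_not_dvd q hq r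
  set M := rootMultiplicity r q
  rw [dvd_iff_isRoot] at hnd
  have hX : (X - C r) ^ M ≠ 0 := pow_ne_zero _ (X_sub_C_ne_zero r)
  have hder : (X - C r) * derivative q = (X - C r) ^ M * (C (M : ℂ) * q₁ + (X - C r) * derivative q₁) := by
    rw [hq₁, derivative_mul, derivative_X_sub_C_pow]
    rcases M with _ | M
    · simp
    · simp only [Nat.add_sub_cancel]; ring
  have h2 : C 2 * (p₁ * (C (M : ℂ) * q₁ + (X - C r) * derivative q₁)) =
      C ((2 * k + 1 : ℕ) : ℂ) * (derivative ((X - C r) * p₁) * q₁) := by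
    apply mul_left_cancel₀ hX
    have : C 2 * (p₁ * ((X - C r) * derivative q)) = C ((2 * k + 1 : ℕ) : ℂ) * (derivative ((X - C r) * p₁) * q) := by
      rw [← h]; ring
    rw [hder] at this
    linear_combination this + C ((2 * k + 1 : ℕ) : ℂ) * derivative ((X - C r) * p₁) * hq₁
  have h3 := congrArg (eval r) h2
  simp only [derivative_mul, derivative_sub, derivative_X, derivative_C, eval_mul, eval_add, eval_sub, eval_C,
    eval_X, sub_self, zero_mul, add_zero, sub_zero, one_mul, eval_one] at h3 ⊢
  by_contra hp
  have h4 : (2 : ℂ) * M = (2 * k + 1 : ℕ) := by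
    apply mul_right_cancel₀ (mul_ne_zero hp hnd)
    linear_combination h3
  have h5 : 2 * M = 2 * k + 1 := by exact_mod_cast h4
  omega

/-- Second conclusion. -/
lemma core_two (d₁ k : ℕ) (hd₁ : 2 ≤ d₁) (f g : ℕ → ℂ[X]) (a : ℂ) (ha : a ≠ 0)
    (hf0 : f 0 = 1) (hg0 : g 0 = C a)
    (hrel : ∀ j ≤ 2 * k + 2, ∑ i ∈ Finset.range (j + 1),
      relT (2 * d₁) (2 * d₁ * k + d₁) f g j i = 0)
    (hf : ∀ i, (f i).natDegree ≤ 2 * d₁ - i)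
    (hg : ∀ i, (g i).natDegree ≤ 2 * d₁ * k + d₁ - i) :
    4 * (f 2).coeff (2 * d₁ - 2) = ((f 1).coeff (d₁ - 1)) ^ 2 := by
  have h1 := core_one d₁ k hd₁ f g a ha hf0 hg0 hrel hf hg
  obtain ⟨m, rfl⟩ : ∃ m, d₁ = m + 1 := ⟨d₁ - 1, by omega⟩
  have hj3 : ∀ i, 3 ≤ i → 2 * (m + 1) - i < m * i := fun i hi => by
    have : m * 3 ≤ m * i := Nat.mul_le_mul_left _ hi
    omega
  have hfm : ∀ i, (f i).natDegree ≤ m * i := by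
    intro i
    rcases i with _ | _ | _ | i
    · simp [hf0]
    · simpa using h1
    · exact (hf _).trans (by omega)
    · exact (hf _).trans (hj3 _ (by omega)).le
  have hrec := core_rec (2 * (m + 1)) _ (2 * k + 2) m (by omega) (by omega) f g a hf0 hg0 hrel hfm
  have hfz : ∀ i, 3 ≤ i → (f i).coeff (m * i) = 0 := fun i hi =>
    coeff_eq_zero_of_natDegree_lt ((hf i).trans_lt (hj3 i hi))
  have e1 : m + 1 - 1 = m * 1 := by omega
  have e2 : 2 * (m + 1) - 2 = m * 2 := by omega
  rw [e1, e2]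
  set b := (f 1).coeff (m * 1) with hb
  set c := (f 2).coeff (m * 2) with hc
  set γ : ℕ → ℂ := fun j => (g j).coeff (m * j) with hγ
  have hγ0 : γ 0 = a := by simp [hγ, hg0]
  have hγl : γ (2 * k + 2) = 0 := by
    apply coeff_eq_zero_of_natDegree_lt
    refine (hg _).trans_lt ?_
    have : m * (2 * k + 2) = 2 * (m * k) + 2 * m := by ring
    have : 2 * (m + 1) * k + (m + 1) = 2 * (m * k) + 2 * k + m + 1 := by ring
    omega
  have hm1 : ((m : ℂ) + 1) ≠ 0 := by exact_mod_cast Nat.succ_ne_zero m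
  have hr1 : 2 * γ 1 = (2 * k + 1) * b * γ 0 := by
    have h := hrec 1 (by omega)
    rw [Finset.sum_range_succ', Finset.sum_range_succ'] at h
    simp only [Finset.range_zero, Finset.sum_empty, zero_add, Nat.sub_zero, Nat.sub_self, hf0] at h
    rw [← hb] at h
    change _ * b * γ 0 + _ * γ 1 = 0 at h
    simp at h
    apply mul_left_cancel₀ hm1
    linear_combination h
  have hr2 : ∀ j, j + 2 ≤ 2 * k + 2 → 2 * (j + 2) * γ (j + 2) =
      b * (2 * k + 1 - 2 * (j + 1)) * γ (j + 1) + 2 * c * (2 * k + 1 - j) * γ j := by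
    intro j hj
    have h := hrec (j + 2) hj
    rw [Finset.sum_range_succ', Finset.sum_range_succ', Finset.sum_range_succ'] at h
    rw [Finset.sum_eq_zero (fun i _ => by rw [hfz _ (by omega)]; ring)] at h
    simp only [zero_add, Nat.sub_zero, hf0, Nat.add_sub_cancel, Nat.reduceAdd,
      show j + 2 - 1 = j + 1 by omega] at h
    change _ * c * γ j + _ * b * γ (j + 1) + _ * γ (j + 2) = 0 at h
    simp at h
    apply mul_left_cancel₀ hm1
    linear_combination h
  -- the truncated polynomial solves the ODE
  set q : ℂ[X] := ∑ j ∈ Finset.range (2 * k + 2), monomial j (γ j) with hq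
  have hqc : ∀ j, q.coeff j = if j < 2 * k + 2 then γ j else 0 := by
    intro j
    simp [hq, finsetSum_coeff, coeff_monomial]
  set p : ℂ[X] := 1 + C b * X + C c * X ^ 2 with hp
  have hdp : derivative p = C b + C (2 * c) * X := by
    have h2 : C (2 : ℂ) = 2 := map_ofNat C 2
    simp [hp, h2]; ring
  have hode : C 2 * (p * derivative q) = C ((2 * k + 1 : ℕ) : ℂ) * (derivative p * q) := by
    have hL : C 2 * (p * derivative q) = C 2 * derivative q + C (2 * b) * (X * derivative q)
        + C (2 * c) * (X * (X * derivative q)) := by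
      simp only [hp, C_mul]; ring
    have hR : C ((2 * k + 1 : ℕ) : ℂ) * (derivative p * q) = C ((2 * k + 1 : ℕ) * b) * q
        + C ((2 * k + 1 : ℕ) * (2 * c)) * (X * q) := by
      rw [hdp]; simp only [C_mul]; ring
    rw [hL, hR]
    ext n
    simp only [coeff_add, coeff_C_mul, coeff_derivative, aux_xd_coeff]
    rcases n with _ | n
    · simp [hqc]
      linear_combination hr1
    · simp only [coeff_X_mul, aux_xd_coeff, hqc]
      rcases lt_trichotomy n (2 * k) with hn | hn | hn
      · rw [if_pos (by omega), if_pos (by omega), if_pos (by omega)]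
        have := hr2 n (by omega)
        push_cast
        linear_combination this
      · subst hn
        have := hr2 (2 * k) (by omega)
        rw [if_neg (by omega), if_pos (by omega), if_pos (by omega)]
        rw [hγl] at this
        push_cast at this ⊢
        linear_combination this
      · rcases Nat.eq_or_lt_of_le hn with hn' | hn'
        · have : n = 2 * k + 1 := by omega
          subst this
          rw [if_neg (by omega), if_neg (by omega), if_pos (by omega)]
          push_cast
          ring
        · rw [if_neg (by omega), if_neg (by omega), if_neg (by omega)]
          ring
  have hq0 : q ≠ 0 := by
    intro h
    have := hqc 0
    rw [h, if_pos (by omega), hγ0] at this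
    exact ha (by simpa using this.symm)
  by_cases hdeg : p.degree = 0
  · have hpc := eq_C_of_degree_eq_zero hdeg
    have hc1 : p.coeff 1 = 0 := by rw [hpc]; simp [coeff_C]
    have hc2 : p.coeff 2 = 0 := by rw [hpc]; simp [coeff_C]
    have hb0 : b = 0 := by simpa [hp, coeff_one, coeff_X, coeff_X_pow] using hc1
    have hc0 : c = 0 := by simpa [hp, coeff_one, coeff_X, coeff_X_pow] using hc2
    rw [hb0, hc0]; ring
  · obtain ⟨r, hr⟩ := IsAlgClosed.exists_root p hdeg
    have h2 := ode_poly p q k hq0 hode r hr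
    rw [hdp] at h2
    have hr' : p.eval r = 0 := hr
    simp [hp] at h2 hr'
    have : 4 * c = b ^ 2 := by
      linear_combination (-(b + 2 * c * r)) * h2 + 4 * c * hr'
    exact this

open MvPolynomial in
/-- restriction to the line `v + z y`. -/
noncomputable def lineRes {n : ℕ} (v y : Fin n → ℂ) : MvPolynomial (Fin n) ℂ →ₐ[ℂ] ℂ[X] :=
  MvPolynomial.aeval (fun p => Polynomial.C (v p) + Polynomial.X * Polynomial.C (y p))

lemma lineRes_derivative {n : ℕ} (v y : Fin n → ℂ) (A : MvPolynomial (Fin n) ℂ) :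
    derivative (lineRes v y A) = ∑ q, C (y q) * lineRes v y (MvPolynomial.pderiv q A) := by
  induction A using MvPolynomial.induction_on with
  | C a => simp [lineRes]
  | add p q hp hq => simp [hp, hq, mul_add, Finset.sum_add_distrib]
  | mul_X p i hp =>
    rw [map_mul, derivative_mul, hp]
    simp only [Derivation.leibniz, smul_eq_mul, map_add, map_mul, mul_add, Finset.sum_add_distrib,
      MvPolynomial.pderiv_X, Finset.sum_mul]
    rw [add_comm]
    congr 1
    · rw [Finset.sum_eq_single i]
      · simp [lineRes]; ring
      · intro b _ hb; simp [hb.symm]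
      · simp
    · exact Finset.sum_congr rfl fun _ _ => by ring

lemma lineRes_euler {n : ℕ} (v y : Fin n → ℂ) (A : MvPolynomial (Fin n) ℂ) (α : ℕ)
    (hA : A.IsHomogeneous α) :
    C (α : ℂ) * lineRes v y A =
      ∑ p, lineRes v y (MvPolynomial.X p) * lineRes v y (MvPolynomial.pderiv p A) := by
  have h := congrArg (lineRes v y) hA.sum_X_mul_pderiv
  simp only [map_sum, map_mul, nsmul_eq_mul, map_natCast] at h
  rw [h]; simp

noncomputable def brk {n : ℕ} (p q : Fin n) (A B : MvPolynomial (Fin n) ℂ) :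
    MvPolynomial (Fin n) ℂ :=
  MvPolynomial.pderiv p A * MvPolynomial.pderiv q B - MvPolynomial.pderiv q A * MvPolynomial.pderiv p B

lemma lineRes_brk {n : ℕ} (v y : Fin n → ℂ) (A B : MvPolynomial (Fin n) ℂ) (α β : ℕ)
    (hA : A.IsHomogeneous α) (hB : B.IsHomogeneous β) :
    ∑ p, ∑ q, lineRes v y (MvPolynomial.X p) * C (y q) * lineRes v y (brk p q A B) =
      C (α : ℂ) * (lineRes v y A * derivative (lineRes v y B)) -
      C (β : ℂ) * (derivative (lineRes v y A) * lineRes v y B) := by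
  have e1 : C (α : ℂ) * (lineRes v y A * derivative (lineRes v y B)) =
    (C (α : ℂ) * lineRes v y A) * derivative (lineRes v y B) := by ring
  have e2 : C (β : ℂ) * (derivative (lineRes v y A) * lineRes v y B) =
    (C (β : ℂ) * lineRes v y B) * derivative (lineRes v y A) := by ring
  rw [e1, e2, lineRes_euler v y A α hA, lineRes_euler v y B β hB, lineRes_derivative,
    lineRes_derivative, Finset.sum_mul_sum, Finset.sum_mul_sum, ← Finset.sum_sub_distrib]
  refine Finset.sum_congr rfl fun p _ => ?_
  rw [← Finset.sum_sub_distrib]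
  refine Finset.sum_congr rfl fun q _ => ?_
  simp only [brk, map_sub, map_mul]
  ring

lemma lin_deg (a b : ℂ) : (C a + X * C b).natDegree ≤ 1 := by
  rw [add_comm, mul_comm]; exact natDegree_linear_le

lemma lineRes_top {n : ℕ} (v y : Fin n → ℂ) (A : MvPolynomial (Fin n) ℂ) (m : ℕ)
    (hA : A.IsHomogeneous m) :
    (lineRes v y A).natDegree ≤ m ∧ (lineRes v y A).coeff m = MvPolynomial.eval y A := by
  have hmon : ∀ s ∈ A.support,
      (∏ p, (C (v p) + X * C (y p)) ^ s p : ℂ[X]).natDegree ≤ m ∧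
      (∏ p, (C (v p) + X * C (y p)) ^ s p : ℂ[X]).coeff m = ∏ p, y p ^ s p := by
    intro s hs
    have hm : ∑ p, s p = m := by
      have := hA (MvPolynomial.mem_support_iff.1 hs)
      rw [← this, Finsupp.weight_apply, Finsupp.sum_fintype] <;> simp
    rw [← hm]
    have key : ∀ t : Finset (Fin n),
      (∏ p ∈ t, (C (v p) + X * C (y p)) ^ s p : ℂ[X]).natDegree ≤ ∑ p ∈ t, s p ∧
      (∏ p ∈ t, (C (v p) + X * C (y p)) ^ s p : ℂ[X]).coeff (∑ p ∈ t, s p) = ∏ p ∈ t, y p ^ s p := by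
      intro t
      induction t using Finset.induction_on with
      | empty => simp
      | insert a t ha ih =>
        rw [Finset.prod_insert ha, Finset.sum_insert ha, Finset.prod_insert ha]
        have h1 : ((C (v a) + X * C (y a)) ^ s a : ℂ[X]).natDegree ≤ s a := by
          simpa using natDegree_pow_le_of_le (s a) (lin_deg (v a) (y a))
        have h2 : ((C (v a) + X * C (y a)) ^ s a : ℂ[X]).coeff (s a) = y a ^ s a := by
          have := coeff_pow_of_natDegree_le (m := s a) (lin_deg (v a) (y a))
          rw [mul_one] at this
          rw [this]; simp [coeff_C]
        refine ⟨natDegree_mul_le_of_le h1 ih.1, ?_⟩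
        rw [coeff_mul_add_eq_of_natDegree_le h1 ih.1, h2, ih.2]
    exact key _
  have hx : lineRes v y A = ∑ s ∈ A.support, C (A.coeff s) * ∏ p, (C (v p) + X * C (y p)) ^ s p := by
    rw [lineRes, MvPolynomial.aeval_def, MvPolynomial.eval₂_eq']; rfl
  rw [hx]
  constructor
  · refine natDegree_sum_le_of_forall_le _ _ fun s hs => ?_
    exact (natDegree_C_mul_le _ _).trans (hmon s hs).1
  · rw [finsetSum_coeff, MvPolynomial.eval_eq']
    refine Finset.sum_congr rfl fun s hs => ?_
    rw [coeff_C_mul, (hmon s hs).2]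

lemma lineRes_eval {n : ℕ} (v y : Fin n → ℂ) (A : MvPolynomial (Fin n) ℂ) (c : ℂ) :
    (lineRes v y A).eval c = MvPolynomial.eval (fun p => v p + c * y p) A := by
  induction A using MvPolynomial.induction_on with
  | C a => simp [lineRes]
  | add p q hp hq => simp [hp, hq]
  | mul_X p i hp => rw [map_mul, eval_mul, hp]; simp [lineRes, mul_comm c]

lemma lineRes_lin {n : ℕ} (v y : Fin n → ℂ) (h : MvPolynomial (Fin n) ℂ)
    (hh : h.IsHomogeneous 1) :
    lineRes v y h = C (MvPolynomial.eval v h) + C (MvPolynomial.eval y h) * X := by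
  have h1 := lineRes_top v y h 1 hh
  have h0 : (lineRes v y h).coeff 0 = MvPolynomial.eval v h := by
    rw [coeff_zero_eq_eval_zero, lineRes_eval]; simp
  conv_lhs => rw [eq_X_add_C_of_natDegree_le_one h1.1]
  rw [h0, h1.2]; ring

lemma exists_one {n : ℕ} (h : MvPolynomial (Fin n) ℂ)
    (hh : h.IsHomogeneous 1) (h0 : h ≠ 0) : ∃ v, MvPolynomial.eval v h = 1 := by
  obtain ⟨x, hx⟩ : ∃ x, MvPolynomial.eval x h ≠ 0 := by
    by_contra hcon
    push Not at hcon
    exact h0 (MvPolynomial.funext fun x => by simpa using hcon x)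
  have hz : MvPolynomial.eval (fun _ => (0 : ℂ)) h = 0 := by
    have := lineRes_top (fun _ => (0 : ℂ)) (fun _ => (0 : ℂ)) h 1 hh
    have h2 := lineRes_lin (fun _ => (0 : ℂ)) (fun _ => (0 : ℂ)) h hh
    have h3 := congrArg (eval 1) h2
    rw [lineRes_eval] at h3
    simp at h3
    simpa using h3
  refine ⟨fun p => 0 + (MvPolynomial.eval x h)⁻¹ * x p, ?_⟩
  have := lineRes_eval (fun _ => 0) x h (MvPolynomial.eval x h)⁻¹
  rw [← this, lineRes_lin _ _ _ hh, hz]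
  simp [hx]

lemma dvd_of_eval {n : ℕ} (h P : MvPolynomial (Fin n) ℂ)
    (hh : h.IsHomogeneous 1) (v : Fin n → ℂ) (hv : MvPolynomial.eval v h = 1)
    (hP : ∀ y, MvPolynomial.eval y h = 0 → MvPolynomial.eval y P = 0) : h ∣ P := by
  set ρ : MvPolynomial (Fin n) ℂ →ₐ[ℂ] MvPolynomial (Fin n) ℂ :=
    MvPolynomial.aeval (fun p => MvPolynomial.X p - h * MvPolynomial.C (v p)) with hρ
  have hz : ρ P = 0 := by
    apply MvPolynomial.funext
    intro x
    rw [map_zero]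
    have e : ∀ Q, MvPolynomial.eval x (ρ Q) =
        MvPolynomial.eval (fun p => x p + (-MvPolynomial.eval x h) * v p) Q := by
      intro Q
      induction Q using MvPolynomial.induction_on with
      | C a => simp [hρ]
      | add p q hp hq => simp [hp, hq]
      | mul_X p i hp => rw [map_mul, map_mul, hp]; simp [hρ, sub_eq_add_neg]
    rw [e]
    apply hP
    rw [← lineRes_eval, lineRes_lin _ _ _ hh, hv]
    simp
  have hd : ∀ Q, h ∣ Q - ρ Q := by
    intro Q
    induction Q using MvPolynomial.induction_on with
    | C a => simp [hρ]
    | add p q hp hq => 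
      rw [map_add, show p + q - (ρ p + ρ q) = (p - ρ p) + (q - ρ q) by ring]
      exact dvd_add hp hq
    | mul_X p i hp =>
      have hX : ρ (MvPolynomial.X i) = MvPolynomial.X i - h * MvPolynomial.C (v i) := by simp [hρ]
      rw [map_mul, hX, show p * MvPolynomial.X i - ρ p * (MvPolynomial.X i - h * MvPolynomial.C (v i)) =
        (p - ρ p) * MvPolynomial.X i + h * (ρ p * MvPolynomial.C (v i)) by ring]
      exact dvd_add (hp.mul_right _) (dvd_mul_right _ _)
  simpa [hz] using hd P

lemma dvd_homog {n : ℕ} (h P : MvPolynomial (Fin n) ℂ) (m : ℕ) (hh : h.IsHomogeneous 1)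
    (hP : P.IsHomogeneous (m + 1)) (hd : h ∣ P) : ∃ Q, Q.IsHomogeneous m ∧ P = h * Q := by
  obtain ⟨Q, rfl⟩ := hd
  refine ⟨MvPolynomial.homogeneousComponent m Q, MvPolynomial.homogeneousComponent_isHomogeneous _ _, ?_⟩
  have e := MvPolynomial.sum_homogeneousComponent Q
  have h1 := MvPolynomial.homogeneousComponent_of_mem (m := m + 1) hP
  rw [if_pos rfl] at h1
  conv_lhs => rw [← h1]
  conv_lhs => rw [← e]
  rw [Finset.mul_sum, map_sum]
  have hterm : ∀ i, MvPolynomial.homogeneousComponent (m + 1) (h * MvPolynomial.homogeneousComponent i Q) =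
      if i = m then h * MvPolynomial.homogeneousComponent i Q else 0 := by
    intro i
    have hi : (h * MvPolynomial.homogeneousComponent i Q).IsHomogeneous (1 + i) :=
      hh.mul (MvPolynomial.homogeneousComponent_isHomogeneous _ _)
    rw [MvPolynomial.homogeneousComponent_of_mem hi]
    exact if_congr (by omega) rfl rfl
  simp only [hterm]
  rw [Finset.sum_ite_eq' _ m]
  split_ifs with hm
  · rfl
  · rw [MvPolynomial.homogeneousComponent_eq_zero m Q (by simpa using hm)]; simp

lemma dvd_pow_homog {n : ℕ} (h P : MvPolynomial (Fin n) ℂ) (m : ℕ) (hh : h.IsHomogeneous 1)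
    (hP : P.IsHomogeneous m) (v : Fin n → ℂ) (hv : MvPolynomial.eval v h = 1) (a : ℕ) (ham : a ≤ m)
    (hdeg : ∀ y, MvPolynomial.eval y h = 0 → (lineRes v y P).natDegree ≤ m - a) :
    ∃ Q, Q.IsHomogeneous (m - a) ∧ P = h ^ a * Q := by
  induction a with
  | zero => exact ⟨P, hP, by simp⟩
  | succ a ih =>
    obtain ⟨Q, hQ, hPQ⟩ := ih (by omega) (fun y hy => (hdeg y hy).trans (by omega))
    have hdv : h ∣ Q := by
      refine dvd_of_eval h Q hh v hv fun y hy => ?_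
      rw [← (lineRes_top v y Q _ hQ).2]
      have : lineRes v y P = lineRes v y Q := by
        rw [hPQ, map_mul, map_pow, lineRes_lin _ _ _ hh, hv, hy]; simp
      rw [← this]
      exact coeff_eq_zero_of_natDegree_lt ((hdeg y hy).trans_lt (by omega))
    obtain ⟨Q', hQ', rfl⟩ := dvd_homog h Q (m - (a + 1)) hh (by convert hQ using 1; omega) hdv
    exact ⟨Q', hQ', by rw [hPQ]; ring⟩

lemma sum_hc {n : ℕ} (F : MvPolynomial (Fin n) ℂ) (d L : ℕ) (hFdeg : F.totalDegree = d)
    (hF0 : MvPolynomial.coeff 0 F = 0) (hL : d < L) :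
    F = ∑ i ∈ Finset.range L, MvPolynomial.homogeneousComponent (d - i) F := by
  have h0 : MvPolynomial.homogeneousComponent 0 F = 0 := by
    rw [MvPolynomial.homogeneousComponent_zero, hF0, map_zero]
  conv_lhs => rw [← MvPolynomial.sum_homogeneousComponent F, hFdeg]
  rw [← Finset.sum_range_reflect]
  apply Finset.sum_subset_zero_on_sdiff
  · intro x; simp; omega
  · intro x hx
    simp at hx
    rw [show d - x = 0 by omega, h0]
  · intro x _; simp

lemma brk_hc {n : ℕ} (p q : Fin n) (A B : MvPolynomial (Fin n) ℂ) (α β M : ℕ) (hM : 2 ≤ M)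
    (hA : A.IsHomogeneous α) (hB : B.IsHomogeneous β) :
    MvPolynomial.homogeneousComponent (M - 2) (brk p q A B) =
      if α + β = M then brk p q A B else 0 := by
  by_cases h0 : α = 0 ∨ β = 0
  · have : brk p q A B = 0 := by
      rcases h0 with rfl | rfl
      · have := MvPolynomial.totalDegree_zero_iff_isHomogeneous (Fin n) |>.2 hA
        rw [MvPolynomial.totalDegree_eq_zero_iff_eq_C.1 this]
        simp [brk]
      · have := MvPolynomial.totalDegree_zero_iff_isHomogeneous (Fin n) |>.2 hB
        rw [MvPolynomial.totalDegree_eq_zero_iff_eq_C.1 this]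
        simp [brk]
    simp [this]
  · push Not at h0
    have hb : (brk p q A B).IsHomogeneous ((α - 1) + (β - 1)) :=
      (hA.pderiv.mul hB.pderiv).sub (hA.pderiv.mul hB.pderiv)
    rw [MvPolynomial.homogeneousComponent_of_mem hb]
    exact if_congr (by omega) rfl rfl

lemma rel_of_poisson {n : ℕ} (F G : MvPolynomial (Fin n) ℂ) (d N K : ℕ) (hK : K ≤ N) (hd : 2 ≤ d)
    (hFdeg : F.totalDegree = d) (hGdeg : G.totalDegree = N)
    (hF0 : MvPolynomial.coeff 0 F = 0) (hG0 : MvPolynomial.coeff 0 G = 0)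
    (hdeg : PoissonDegLT F G ((d : ℤ) + N - K)) (v y : Fin n → ℂ) :
    ∀ j ≤ K, ∑ i ∈ Finset.range (j + 1),
      relT d N (fun i => lineRes v y (MvPolynomial.homogeneousComponent (d - i) F))
        (fun i => lineRes v y (MvPolynomial.homogeneousComponent (N - i) G)) j i = 0 := by
  intro j hj
  set L := d + N + 1 with hL
  set f := fun i => MvPolynomial.homogeneousComponent (d - i) F with hf
  set g := fun i => MvPolynomial.homogeneousComponent (N - i) G with hg
  have hfh : ∀ i, (f i).IsHomogeneous (d - i) := fun i =>
    MvPolynomial.homogeneousComponent_isHomogeneous _ _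
  have hgh : ∀ i, (g i).IsHomogeneous (N - i) := fun i =>
    MvPolynomial.homogeneousComponent_isHomogeneous _ _
  have hfz : ∀ i, d ≤ i → f i = 0 := fun i hi => by
    simp only [hf]
    rw [show d - i = 0 by omega, MvPolynomial.homogeneousComponent_zero, hF0, map_zero]
  have hgz : ∀ i, N ≤ i → g i = 0 := fun i hi => by
    simp only [hg]
    rw [show N - i = 0 by omega, MvPolynomial.homogeneousComponent_zero, hG0, map_zero]
  have key : ∀ p q, ∑ i ∈ Finset.range L, ∑ l ∈ Finset.range L,
      (if i + l = j then brk p q (f i) (g l) else 0) = 0 := by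
    intro p q
    have h1 : brk p q F G = ∑ i ∈ Finset.range L, ∑ l ∈ Finset.range L, brk p q (f i) (g l) := by
      conv_lhs => rw [sum_hc F d L hFdeg hF0 (by omega), sum_hc G N L hGdeg hG0 (by omega)]
      simp only [brk, map_sum, Finset.sum_mul_sum, ← Finset.sum_sub_distrib, hf, hg]
    have h2 : MvPolynomial.homogeneousComponent (d + N - j - 2) (brk p q F G) = 0 := by
      rcases hdeg p q with h | h
      · unfold brk; rw [h, map_zero]
      · apply MvPolynomial.homogeneousComponent_eq_zero
        unfold brk
        omega
    rw [h1] at h2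
    simp only [map_sum] at h2
    refine Eq.trans ?_ h2
    refine Finset.sum_congr rfl fun i _ => Finset.sum_congr rfl fun l _ => ?_
    rw [brk_hc p q _ _ _ _ _ (by omega) (hfh i) (hgh l)]
    by_cases hi : d ≤ i
    · simp [hfz i hi, brk]
    by_cases hl : N ≤ l
    · simp [hgz l hl, brk]
    exact if_congr (by omega) rfl rfl
  have key2 : ∑ i ∈ Finset.range L, ∑ l ∈ Finset.range L,
      (if i + l = j then ∑ p, ∑ q, lineRes v y (MvPolynomial.X p) * C (y q) *
        lineRes v y (brk p q (f i) (g l)) else 0) = 0 := by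
    have : ∑ p, ∑ q, lineRes v y (MvPolynomial.X p) * C (y q) * lineRes v y
      (∑ i ∈ Finset.range L, ∑ l ∈ Finset.range L,
      (if i + l = j then brk p q (f i) (g l) else 0)) = 0 := by simp [key]
    refine Eq.trans ?_ this
    simp only [map_sum, Finset.mul_sum]
    symm
    rw [Finset.sum_congr rfl fun p _ => Finset.sum_comm, Finset.sum_comm]
    refine Finset.sum_congr rfl fun i _ => ?_
    rw [Finset.sum_congr rfl fun p _ => Finset.sum_comm, Finset.sum_comm]
    refine Finset.sum_congr rfl fun l _ => ?_
    split_ifs <;> simp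
  have key3 : ∑ i ∈ Finset.range (j + 1), ∑ p, ∑ q, lineRes v y (MvPolynomial.X p) * C (y q) *
        lineRes v y (brk p q (f i) (g (j - i))) = 0 := by
    refine Eq.trans ?_ key2
    apply Finset.sum_subset_zero_on_sdiff
    · intro x; simp; omega
    · intro x hx
      simp at hx
      exact Finset.sum_eq_zero fun l _ => if_neg (by omega)
    · intro i hi
      simp at hi
      rw [Finset.sum_eq_single (j - i), if_pos (by omega)]
      · intro l _ hl; exact if_neg (by omega)
      · intro h; simp at h; omega
  have : ∑ i ∈ Finset.range (j + 1), relT d N (fun i => lineRes v y (f i))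
        (fun i => lineRes v y (g i)) j i = X * ∑ i ∈ Finset.range (j + 1), ∑ p, ∑ q,
          lineRes v y (MvPolynomial.X p) * C (y q) * lineRes v y (brk p q (f i) (g (j - i))) := by
    rw [Finset.mul_sum]
    refine Finset.sum_congr rfl fun i hi => ?_
    rw [Finset.mem_range] at hi
    rw [lineRes_brk v y _ _ _ _ (hfh i) (hgh (j - i))]
    unfold relT
    rw [Nat.cast_sub (show j - i ≤ N by omega)]
    by_cases hdi : d ≤ i
    · simp [hfz i hdi]
    · rw [Nat.cast_sub (show i ≤ d by omega)]
      ring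
  rw [key3, mul_zero] at this
  exact this

end Aux18

open MvPolynomial

theorem stmt_18 {n : ℕ} (F G h : MvPolynomial (Fin n) ℂ)
    (d₁ : ℕ) (hd₁ : 2 ≤ d₁) (d s : ℕ) (hd : d = 2 * d₁) (hs : s = d - 1)
    (k : ℕ) (hk : 1 ≤ k) (N : ℕ) (hN : N = 2 * d₁ * k + d₁) (aN : ℂ)
    (hdN : d ≤ N)
    (hFdeg : F.totalDegree = d) (hGdeg : G.totalDegree = N)
    (hF0 : MvPolynomial.coeff 0 F = 0) (hG0 : MvPolynomial.coeff 0 G = 0)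
    (hh : h.IsHomogeneous 1)
    (hFd : homogeneousComponent d F = h ^ d)
    (haN : aN ≠ 0) (hGN : homogeneousComponent N G = aN • h ^ N)
    (hdeg : PoissonDegLT F G ((d : ℤ) + N - 2 * k - 2)) :
    ∃ Ft Fh : MvPolynomial (Fin n) ℂ,
      Ft.IsHomogeneous (d₁ - 1) ∧ Fh.IsHomogeneous (s - 2) ∧
      homogeneousComponent s F = h ^ d₁ * Ft ∧
      homogeneousComponent (s - 1) F = (4 : ℂ)⁻¹ • (Ft ^ 2 + h * Fh) := by
  have hh0 : h ≠ 0 := by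
    rintro rfl
    rw [zero_pow (by omega)] at hFd
    have h1 : F ≠ 0 := by rintro rfl; simp at hFdeg; omega
    obtain ⟨t, ht, hte⟩ := F.support.exists_mem_eq_sup
      (MvPolynomial.support_nonempty.2 h1) (fun m => m.sum fun _ => id)
    have hc := congrArg (MvPolynomial.coeff t) hFd
    rw [MvPolynomial.coeff_homogeneousComponent, if_pos] at hc
    · exact MvPolynomial.mem_support_iff.1 ht (by simpa using hc)
    · rw [← hFdeg]; unfold MvPolynomial.totalDegree; exact hte.symm
  obtain ⟨v, hv⟩ := Aux18.exists_one h hh hh0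
  have hKN : 2 * k + 2 ≤ N := by
    have : 2 * k ≤ d₁ * k := Nat.mul_le_mul_right _ hd₁
    have : 2 * d₁ * k = 2 * (d₁ * k) := by ring
    omega
  have hrel := fun y => Aux18.rel_of_poisson F G d N (2 * k + 2) hKN (by omega) hFdeg hGdeg hF0 hG0
    (by convert hdeg using 1; push_cast; ring) v y
  subst hd hN
  have hline : ∀ y, MvPolynomial.eval y h = 0 → Aux18.lineRes v y h = 1 := fun y hy => by
    rw [Aux18.lineRes_lin _ _ _ hh, hv, hy]; simp
  have hf0 : ∀ y, MvPolynomial.eval y h = 0 →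
      Aux18.lineRes v y (homogeneousComponent (2 * d₁ - 0) F) = 1 := fun y hy => by
    rw [Nat.sub_zero, hFd, map_pow, hline y hy, one_pow]
  have hg0 : ∀ y, MvPolynomial.eval y h = 0 →
      Aux18.lineRes v y (homogeneousComponent (2 * d₁ * k + d₁ - 0) G) = Polynomial.C aN := fun y hy => by
    rw [Nat.sub_zero, hGN, map_smul, map_pow, hline y hy, one_pow, Polynomial.smul_eq_C_mul, mul_one]
  have hdegc : ∀ y m (P : MvPolynomial (Fin n) ℂ),
      (Aux18.lineRes v y (homogeneousComponent m P)).natDegree ≤ m := fun y m P =>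
    (Aux18.lineRes_top v y _ m (homogeneousComponent_isHomogeneous _ _)).1
  have h1 := fun y hy => Aux18.core_one d₁ k hd₁ _ _ aN haN (hf0 y hy) (hg0 y hy) (hrel y)
    (fun i => hdegc y _ F) (fun i => hdegc y _ G)
  have h2 := fun y hy => Aux18.core_two d₁ k hd₁ _ _ aN haN (hf0 y hy) (hg0 y hy) (hrel y)
    (fun i => hdegc y _ F) (fun i => hdegc y _ G)
  obtain ⟨Ft, hFt, hFte⟩ := Aux18.dvd_pow_homog h (homogeneousComponent s F) s hh
    (homogeneousComponent_isHomogeneous _ _) v hv d₁ (by omega) (fun y hy => by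
      subst hs; exact (h1 y hy).trans (by omega))
  have hFt' : Ft.IsHomogeneous (d₁ - 1) := by convert hFt using 1; omega
  have hB : (homogeneousComponent (s - 1) F).IsHomogeneous (s - 1) :=
    homogeneousComponent_isHomogeneous _ _
  have hD : ((4 : ℂ) • homogeneousComponent (s - 1) F - Ft ^ 2).IsHomogeneous (s - 2 + 1) := by
    have e1 : s - 2 + 1 = s - 1 := by omega
    have e2 : (d₁ - 1) * 2 = s - 1 := by omega
    rw [e1]
    refine MvPolynomial.IsHomogeneous.sub ?_ (by rw [← e2]; exact hFt'.pow 2)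
    rw [MvPolynomial.smul_eq_C_mul]
    simpa using (MvPolynomial.isHomogeneous_C (Fin n) (4 : ℂ)).mul hB
  obtain ⟨Fh, hFh, hFhe⟩ := Aux18.dvd_homog h _ _ hh hD (by
    refine Aux18.dvd_of_eval h _ hh v hv fun y hy => ?_
    have h3 := h2 y hy
    have e1 : Aux18.lineRes v y (homogeneousComponent (2 * d₁ - 1) F) = Aux18.lineRes v y Ft := by
      rw [← hs, hFte, map_mul, map_pow, hline y hy]; simp
    have e2 : 2 * d₁ - 2 = s - 1 := by omega
    simp only [e1, e2] at h3
    rw [(Aux18.lineRes_top v y _ _ hB).2, (Aux18.lineRes_top v y _ _ hFt').2] at h3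
    simp [h3])
  refine ⟨Ft, Fh, hFt', hFh, hFte, ?_⟩
  rw [← hFhe]
  simp
end

section
/- Let d₁ ≥ 2 be an integer, set d = 2d₁ and s = d−1, let k be a positive integer, set N = 2d₁k + d₁, and let t ≥ 1 be an integer dividing d₁. Assume the setup with deg h = t where, in addition, h is a square-free polynomial, and assume deg[F,G] < d + N − 2k − 2. Then there exist homogeneous polynomials F̃ of degree d₁ − 1 and F̂ of degree s − t − 1 such that F_s = h^{d₁/t}·F̃ and F_{s−1} = (1/4)·(F̃² + h·F̂). -/
open MvPolynomial

/-- A nonconstant homogeneous polynomial `h` is *not a proper power* if it cannot be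
written as `b • g ^ k` with `g` homogeneous of degree strictly smaller than `deg h`
and `k ≥ 2`. -/
def NotProperPower {n : ℕ} (h : MvPolynomial (Fin n) ℂ) : Prop :=
  ¬ ∃ (b : ℂ) (g : MvPolynomial (Fin n) ℂ) (k m : ℕ),
      2 ≤ k ∧ g.IsHomogeneous m ∧ m < h.totalDegree ∧ h = b • g ^ k

lemma quad_ode {K : Type*} [Field K] [CharZero K] (k : ℕ) (Q P : Polynomial K) (hP : P ≠ 0)
    (hco : IsCoprime Q (Polynomial.derivative Q)) (hu : ¬ IsUnit Q)
    (hode : 2 * Q * Polynomial.derivative P = (2 * (k : Polynomial K) + 1) * Polynomial.derivative Q * P) : False := by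
  have hQ0 : Q ≠ 0 := by
    rintro rfl
    rw [Polynomial.derivative_zero] at hco
    exact not_isCoprime_zero_zero hco
  obtain ⟨S, hS, hnd⟩ := (FiniteMultiplicity.of_not_isUnit hu hP).exists_eq_pow_mul_and_not_dvd
  set a := multiplicity Q P
  apply hnd
  have h1 : Q ^ a * (2 * Q * Polynomial.derivative S)
      = Q ^ a * ((2 * (k : Polynomial K) + 1 - 2 * (a : Polynomial K)) * Polynomial.derivative Q * S) := by
    have h2 : Q * Polynomial.derivative (Q ^ a) = (a : Polynomial K) * Q ^ a * Polynomial.derivative Q := by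
      rw [Polynomial.derivative_pow]
      rcases a with _ | a
      · simp
      · simp; ring
    rw [hS, Polynomial.derivative_mul] at hode
    linear_combination hode - 2 * S * h2
  have h3 := mul_left_cancel₀ (pow_ne_zero _ hQ0) h1
  have h4 : Q ∣ Polynomial.derivative Q * ((2 * (k : Polynomial K) + 1 - 2 * (a : Polynomial K)) * S) :=
    ⟨2 * Polynomial.derivative S, by linear_combination -h3⟩
  have h5 := hco.dvd_of_dvd_mul_left h4
  have h6 : (2 * (k : K) + 1 - 2 * (a : K)) ≠ 0 := by
    intro h
    have : ((2 * (k : ℤ) + 1 - 2 * (a : ℤ) : ℤ) : K) = 0 := by push_cast; exact h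
    have := Int.cast_eq_zero.mp this
    omega
  have h7 : (2 * (k : Polynomial K) + 1 - 2 * (a : Polynomial K)) = Polynomial.C (2 * (k : K) + 1 - 2 * (a : K)) := by
    simp only [map_sub, map_add, map_mul, map_natCast, map_ofNat, map_one]
  rw [h7] at h5
  have h8 : IsUnit (Polynomial.C (2 * (k : K) + 1 - 2 * (a : K))) := Polynomial.isUnit_C.mpr (isUnit_iff_ne_zero.mpr h6)
  exact (h8.dvd_mul_left).mp h5

lemma rec_field {K : Type*} [Field K] [CharZero K] (k : ℕ) (u0 u1 u2 : K) (v : ℕ → K)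
    (hv0 : v 0 ≠ 0) (hvk : v (2 * k + 2) = 0)
    (h1 : (2 * (k : K) + 1) * u1 * v 0 = 2 * u0 * v 1)
    (hr : ∀ J : ℕ, J ≤ 2 * k → 2 * ((J : K) + 2) * u0 * v (J + 2) =
      (2 * (k : K) + 1 - 2 * ((J : K) + 1)) * u1 * v (J + 1) + (2 * (2 * (k : K) + 1) - 2 * (J : K)) * u2 * v J) :
    u1 ^ 2 = 4 * u0 * u2 := by
  by_contra hne
  set Q : Polynomial K := Polynomial.C u0 + Polynomial.C u1 * Polynomial.X + Polynomial.C u2 * Polynomial.X ^ 2 with hQ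
  set w : ℕ → K := fun j => if j < 2 * k + 2 then v j else 0 with hw
  set P : Polynomial K := ∑ j ∈ Finset.range (2 * k + 2), Polynomial.C (v j) * Polynomial.X ^ j with hPdef
  have hPc : ∀ j, P.coeff j = w j := by
    intro j
    simp [hPdef, hw]
  have hQ' : Polynomial.derivative Q = Polynomial.C u1 + Polynomial.C (2 * u2) * Polynomial.X := by
    simp [hQ, map_mul]; ring_nf; simp only [map_ofNat]
  have hdisc : u1 ^ 2 - 4 * u0 * u2 ≠ 0 := sub_ne_zero.mpr hne
  apply quad_ode k Q P
  · intro h0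
    have := hPc 0
    rw [h0] at this
    simp [hw] at this
    exact hv0 this.symm
  · have h8 : IsUnit (Polynomial.C (u1 ^ 2 - 4 * u0 * u2)) := Polynomial.isUnit_C.mpr (isUnit_iff_ne_zero.mpr hdisc)
    obtain ⟨c, hc⟩ := h8.exists_left_inv
    refine ⟨c * (- 4 * Polynomial.C u2), c * (Polynomial.C u1 + Polynomial.C (2 * u2) * Polynomial.X), ?_⟩
    rw [← hc, hQ', hQ]
    simp only [map_mul, map_sub, map_pow, map_ofNat]
    ring
  · intro hu
    obtain ⟨c, hc, hcQ⟩ := Polynomial.isUnit_iff.mp hu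
    have e1 : Q.coeff 1 = u1 := by simp [hQ, Polynomial.coeff_X, Polynomial.coeff_C]
    have e2 : Q.coeff 2 = u2 := by simp [hQ, Polynomial.coeff_X, Polynomial.coeff_C]
    rw [← hcQ] at e1 e2
    simp [Polynomial.coeff_C] at e1 e2
    apply hdisc
    rw [← e1, ← e2]; ring
  · rw [hQ']
    have key : ∀ n, (2 * Q * Polynomial.derivative P).coeff n = ((2 * (k : Polynomial K) + 1) * (Polynomial.C u1 + Polynomial.C (2 * u2) * Polynomial.X) * P).coeff n := by
      intro n
      have eL : 2 * Q * Polynomial.derivative P = Polynomial.C (2 * u0) * Polynomial.derivative P + Polynomial.C (2 * u1) * (Polynomial.derivative P * Polynomial.X) + Polynomial.C (2 * u2) * (Polynomial.derivative P * Polynomial.X ^ 2) := by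
        simp only [hQ, map_mul, map_ofNat]; ring
      have eR : (2 * (k : Polynomial K) + 1) * (Polynomial.C u1 + Polynomial.C (2 * u2) * Polynomial.X) * P = Polynomial.C ((2 * (k : K) + 1) * u1) * P + Polynomial.C ((2 * (k : K) + 1) * (2 * u2)) * (P * Polynomial.X) := by
        simp only [map_mul, map_ofNat, map_add, map_one, map_natCast]; ring
      rw [eL, eR]
      rcases n with _ | _ | n
      · simp [Polynomial.coeff_derivative, hPc, hw, Polynomial.coeff_X_pow, Polynomial.mul_coeff_zero]
        linear_combination -h1
      · simp only [Polynomial.coeff_add, Polynomial.coeff_C_mul, Polynomial.coeff_mul_X, Polynomial.coeff_mul_X_pow', Polynomial.coeff_derivative, hPc]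
        have := hr 0 (by omega)
        simp [hw] at this ⊢
        rcases k with _ | k
        · simp at this hvk ⊢
          rw [hvk] at this
          linear_combination this
        · rw [if_pos (by omega)]
          linear_combination this
      · simp only [Polynomial.coeff_add, Polynomial.coeff_C_mul, Polynomial.coeff_mul_X, Polynomial.coeff_mul_X_pow, Polynomial.coeff_derivative, hPc]
        have c1 : n + 1 + 1 + 1 = n + 3 := rfl
        have c2 : n + 1 + 1 = n + 2 := rfl
        simp only [c1, c2]
        by_cases hn : n + 3 ≤ 2 * k + 2
        · have := hr (n + 1) (by omega)
          have e3 : w (n + 3) = v (n + 3) := by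
            simp only [hw]; split_ifs with h
            · rfl
            · rw [show n + 3 = 2 * k + 2 by omega, hvk]
          have e2 : w (n + 2) = v (n + 2) := by simp only [hw]; rw [if_pos (by omega)]
          have e1 : w (n + 1) = v (n + 1) := by simp only [hw]; rw [if_pos (by omega)]
          rw [e1, e2, e3]
          push_cast at this ⊢
          rw [show n + 1 + 2 = n + 3 by rfl, show n + 1 + 1 = n + 2 by rfl] at this
          linear_combination this
        · have e3 : w (n + 3) = 0 := by simp only [hw]; rw [if_neg (by omega)]
          have e2 : w (n + 2) = 0 := by simp only [hw]; rw [if_neg (by omega)]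
          rw [e3, e2]
          by_cases hn2 : n + 1 = 2 * k + 1
          · obtain rfl : n = 2 * k := by omega
            push_cast
            ring
          · have e1 : w (n + 1) = 0 := by simp only [hw]; rw [if_neg (by omega)]
            rw [e1]; ring
    exact Polynomial.ext key

lemma sqf_pow_dvd {R : Type*} [CommRing R] [IsDomain R] [UniqueFactorizationMonoid R] (e : ℕ) (A : R) (h : R) :
    Squarefree h → (∀ p, Prime p → p ∣ h → p ^ e ∣ A) → h ^ e ∣ A := by
  classical
  induction h using WfDvdMonoid.induction_on_irreducible with
  | zero => intro h; exact absurd h not_squarefree_zero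
  | unit u hu => intro _ _; exact (hu.pow e).dvd
  | mul a i ha hi ih =>
    intro hs hp
    rw [mul_pow]
    have := (squarefree_mul_iff.mp hs)
    apply IsRelPrime.mul_dvd (this.1.pow)
    · exact hp i hi.prime (dvd_mul_right _ _)
    · exact ih this.2.2 fun p h1 h2 => hp p h1 (h2.mul_left _)

lemma exists_pderiv {n : ℕ} (p : MvPolynomial (Fin n) ℂ) (hp : Prime p) : ∃ q, ¬ p ∣ pderiv q p := by
  by_contra hcon
  push Not at hcon
  have hz : ∀ q, pderiv q p = 0 := by
    intro q
    by_contra hne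
    have h1 := totalDegree_le_of_dvd_of_isDomain (hcon q) hne
    have h2 : (pderiv q p).totalDegree < p.totalDegree := by
      obtain ⟨m, hm, hm2⟩ := Finset.exists_mem_eq_sup (pderiv q p).support (by simpa using hne) (fun m => m.sum fun _ e => e)
      have h3 : (pderiv q p).totalDegree = m.sum fun _ e => e := hm2
      rw [mem_support_iff, coeff_pderiv] at hm
      have h4 : m + Finsupp.single q 1 ∈ p.support := by
        rw [mem_support_iff]; intro h; simp [h] at hm
      have := le_totalDegree h4
      rw [Finsupp.sum_add_index' (by simp) (by simp), Finsupp.sum_single_index rfl] at this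
      omega
    omega
  have hc : p = C (coeff 0 p) := by
    ext m
    rw [coeff_C]
    split_ifs with h
    · rw [h]
    · obtain ⟨q, hq⟩ := Finsupp.ne_iff.mp (Ne.symm h)
      have := congrArg (coeff (m - Finsupp.single q 1)) (hz q)
      rw [coeff_pderiv, tsub_add_cancel_of_le] at this
      · simp at this
        exact this.resolve_right (Nat.cast_add_one_ne_zero _)
      · simp at hq ⊢; omega
  apply hp.not_isUnit
  rw [hc]
  have : coeff 0 p ≠ 0 := by
    intro h; rw [h] at hc; exact hp.ne_zero (by simpa using hc)
  exact (isUnit_iff_ne_zero.mpr this).map C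

lemma der_scale {R : Type*} [CommRing R] [Algebra ℂ R] (D : Derivation ℂ R R) (p x y : R) (a b : ℕ)
    (h : p ^ a * x = p ^ b * y) :
    p ^ a * (p * D x) = p ^ b * (((b : R) - a) * D p * y + p * D y) := by
  have hp : ∀ a : ℕ, p * D (p ^ a) = a * p ^ a * D p := by
    intro a
    rw [Derivation.leibniz_pow]
    rcases a with _ | a
    · simp
    · simp only [Nat.add_sub_cancel, nsmul_eq_mul, smul_eq_mul]; ring
  have h2 := congrArg D h
  rw [Derivation.leibniz, Derivation.leibniz] at h2
  simp only [smul_eq_mul] at h2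
  linear_combination p * h2 - x * hp a + y * hp b - a * D p * h

lemma core.{u} {R : Type u} [CommRing R] [IsDomain R] [Algebra ℂ R] (D : Derivation ℂ R R) (p : R) (hp : Prime p)
    (hD : ¬ p ∣ D p) (e t k ω : ℕ) (he : 1 ≤ e) (hω : e ≤ ω) (hωt : 2 ≤ ω * t)
    (f g : ℕ → R) (h' w u1 u2 : R) (hh' : ¬ p ∣ h') (hw : ¬ p ∣ w)
    (hf0 : f 0 = p ^ (2 * e) * h' ^ (2 * e)) (hg0 : g 0 = p ^ (e * (2 * k + 1)) * w)
    (hu1 : p ^ ω * f 1 = p ^ (2 * e) * u1) (hu2 : p ^ (2 * ω) * f 2 = p ^ (2 * e) * u2)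
    (hrel : ∀ J ≤ 2 * k + 2, ∑ x ∈ Finset.HasAntidiagonal.antidiagonal J,
      (((2 * e * t : ℕ) - (x.1 : R)) * f x.1 * D (g x.2)
        - ((e * (2 * k + 1) * t : ℕ) - (x.2 : R)) * g x.2 * D (f x.1)) = 0) :
    p ∣ u1 ^ 2 - 4 * h' ^ (2 * e) * u2 := by
  have hp0 : p ≠ 0 := hp.ne_zero
  -- the u sequence
  have hu : ∀ i, ∃ u, p ^ (i * ω) * f i = p ^ (2 * e) * u ∧ (3 ≤ i → p ∣ u) := by
    intro i
    rcases i with _ | _ | _ | i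
    · exact ⟨h' ^ (2 * e), by simp [hf0], by simp⟩
    · exact ⟨u1, by simpa using hu1, by simp⟩
    · exact ⟨u2, by simpa using hu2, by simp⟩
    · have : 2 * e + 1 ≤ (i + 3) * ω := by nlinarith
      obtain ⟨c, hc⟩ := Nat.exists_eq_add_of_le this
      refine ⟨p * (p ^ c * f (i + 3)), ?_, fun _ => dvd_mul_right _ _⟩
      rw [show (i + 1 + 1 + 1) = i + 3 by rfl, hc]; ring
  choose u hu hu3 using hu
  have hu0' : u 0 = h' ^ (2 * e) := by
    apply mul_left_cancel₀ (pow_ne_zero (2 * e) hp0)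
    rw [← hu 0, ← hf0]; simp
  have hu1' : u 1 = u1 := by
    apply mul_left_cancel₀ (pow_ne_zero (2 * e) hp0)
    rw [← hu 1, ← hu1]; simp
  have hu2' : u 2 = u2 := by
    apply mul_left_cancel₀ (pow_ne_zero (2 * e) hp0)
    rw [← hu 2, ← hu2]
  -- the exponent m
  obtain ⟨m, hmM, hm, hm'⟩ : ∃ m ≤ e * (2 * k + 1), (∀ j ≤ 2 * k + 2, p ^ m ∣ p ^ (j * ω) * g j) ∧
      ¬ (∀ j ≤ 2 * k + 2, p ^ (m + 1) ∣ p ^ (j * ω) * g j) := by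
    by_contra hcon
    push Not at hcon
    have : ∀ m ≤ e * (2 * k + 1) + 1, (∀ j ≤ 2 * k + 2, p ^ m ∣ p ^ (j * ω) * g j) := by
      intro m
      induction m with
      | zero => intro _ j _; simp
      | succ m ih => intro hm; exact hcon m (by omega) (ih (by omega))
    have h0 := this _ le_rfl 0 (by omega)
    rw [hg0, zero_mul, pow_zero, one_mul, pow_succ] at h0
    exact hw ((mul_dvd_mul_iff_left (pow_ne_zero _ hp0)).mp h0)
  obtain ⟨r, hr⟩ := Nat.exists_eq_add_of_le hmM
  have hv : ∀ j, ∃ v, j ≤ 2 * k + 2 → p ^ (j * ω) * g j = p ^ m * v := by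
    intro j
    by_cases hj : j ≤ 2 * k + 2
    · obtain ⟨v, hv⟩ := hm j hj
      exact ⟨v, fun _ => hv⟩
    · exact ⟨0, fun h => absurd h hj⟩
  choose v hv using hv
  have hv0 : v 0 = p ^ r * w := by
    apply mul_left_cancel₀ (pow_ne_zero m hp0)
    rw [← hv 0 (by omega), hg0, hr]; ring
  -- the scaled relation
  set co : ℕ → ℕ → ℤ := fun i j => ((2 * e * t : ℕ) - (i : ℤ)) * ((m : ℤ) - (j * ω : ℕ))
      - ((e * (2 * k + 1) * t : ℕ) - (j : ℤ)) * ((2 * e : ℕ) - (i * ω : ℕ)) with hco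
  have hmain : ∀ J ≤ 2 * k + 2, p ∣ ∑ x ∈ Finset.HasAntidiagonal.antidiagonal J, (co x.1 x.2 : R) * u x.1 * v x.2 := by
    intro J hJ
    have h1 : p ^ (2 * e + m) * ∑ x ∈ Finset.HasAntidiagonal.antidiagonal J,
        (D p * ((co x.1 x.2 : R) * u x.1 * v x.2) + p * (((2 * e * t : ℕ) - (x.1 : R)) * u x.1 * D (v x.2)
          - ((e * (2 * k + 1) * t : ℕ) - (x.2 : R)) * v x.2 * D (u x.1))) = 0 := by
      rw [← mul_zero (p ^ (J * ω + 1)), ← hrel J hJ, Finset.mul_sum, Finset.mul_sum]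
      apply Finset.sum_congr rfl
      rintro ⟨i, j⟩ hij
      rw [Finset.HasAntidiagonal.mem_antidiagonal] at hij
      simp only at hij ⊢
      have e1 := der_scale D p _ _ _ _ (hu i)
      have e2 := der_scale D p _ _ _ _ (hv j (by omega))
      have e3 := hu i
      have e4 := hv j (by omega)
      rw [← hij, add_mul, pow_add, pow_add, pow_add, pow_one]
      set A := p ^ (i * ω)
      set B := p ^ (j * ω)
      set E := p ^ (2 * e)
      set M := p ^ m
      simp only [hco]
      push_cast at e1 e2 ⊢
      linear_combination (-((2 * e * t) - (i : R))) * (B * (p * D (g j)) * e3 + E * u i * e2)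
       + ((e * (2 * k + 1) * t) - (j : R)) * (A * (p * D (f i)) * e4 + M * v j * e1)
    have h2 := (mul_eq_zero.mp h1).resolve_left (pow_ne_zero _ hp0)
    rw [Finset.sum_add_distrib, ← Finset.mul_sum, ← Finset.mul_sum] at h2
    have h3 : p ∣ D p * ∑ x ∈ Finset.HasAntidiagonal.antidiagonal J, (co x.1 x.2 : R) * u x.1 * v x.2 :=
      ⟨_, (eq_neg_of_add_eq_zero_left h2).trans (mul_neg _ _).symm⟩
    exact (hp.dvd_or_dvd h3).resolve_left hD
  -- pass to the quotient
  have : (Ideal.span {p}).IsPrime := (Ideal.span_singleton_prime hp0).mpr hp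
  obtain ⟨κ, _, _, _, π, hπ⟩ : ∃ (κ : Type u) (_ : CommRing κ) (_ : IsDomain κ) (_ : CharZero κ) (π : R →+* κ),
      ∀ x, π x = 0 ↔ p ∣ x :=
    ⟨R ⧸ Ideal.span {p}, inferInstance, inferInstance,
      charZero_of_injective_algebraMap (R := ℂ) (algebraMap ℂ (R ⧸ Ideal.span {p})).injective,
      Ideal.Quotient.mk (Ideal.span {p}), fun x => by
        rw [Ideal.Quotient.eq_zero_iff_mem, Ideal.mem_span_singleton]⟩
  have hmain' : ∀ J ≤ 2 * k + 2, ∑ x ∈ Finset.HasAntidiagonal.antidiagonal J, (co x.1 x.2 : κ) * π (u x.1) * π (v x.2) = 0 := by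
    intro J hJ
    have := (hπ _).mpr (hmain J hJ)
    simpa [map_sum] using this
  have hu0n : π (u 0) ≠ 0 := by
    rw [Ne, hπ, hu0']; exact fun h => hh' (hp.dvd_of_dvd_pow h)
  have hr0 : r = 0 := by
    by_contra hrne
    have hex : ∃ j, j ≤ 2 * k + 2 ∧ ¬ p ∣ v j := by
      by_contra hcon
      push Not at hcon
      apply hm'
      intro j hj
      rw [hv j hj, pow_succ]
      exact mul_dvd_mul_left _ (hcon j hj)
    classical
    obtain ⟨hj1, hj2⟩ := Nat.find_spec hex
    set j := Nat.find hex with hjdef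
    have hmin : ∀ i < j, p ∣ v i := by
      intro i hi
      have := Nat.find_min hex hi
      by_contra hh
      exact this ⟨by omega, hh⟩
    have hs := hmain' j hj1
    rw [Finset.sum_eq_single (0, j)] at hs
    · simp only at hs
      rw [mul_assoc, mul_eq_zero] at hs
      rcases hs with hs | hs
      · have h0 := Int.cast_eq_zero.mp hs
        simp only [hco] at h0
        rw [hr] at h0
        push_cast at h0
        have hr1 : (r : ℤ) ≥ 1 := by omega
        have ht1 : (1 : ℤ) ≤ t := by
          rcases t with _ | t
          · omega
          · push_cast; omega
        have hx : (2 * (e : ℤ)) * ((t : ℤ) * r + j * ((ω : ℤ) * t - 1)) = 0 := by linear_combination -h0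
        have hωt' : (2 : ℤ) ≤ ω * t := by exact_mod_cast hωt
        have y1 : 0 < (t : ℤ) * r := by positivity
        have y2 : 0 ≤ (j : ℤ) * ((ω : ℤ) * t - 1) := mul_nonneg (by positivity) (by linarith)
        have y3 : 0 < (2 * (e : ℤ)) := by omega
        have := mul_pos y3 (add_pos_of_pos_of_nonneg y1 y2)
        omega
      · rcases mul_eq_zero.mp hs with hs | hs
        · exact hu0n hs
        · exact hj2 ((hπ _).mp hs)
    · rintro ⟨a, b⟩ hab hne
      rw [Finset.HasAntidiagonal.mem_antidiagonal] at hab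
      simp only at hab ⊢
      have : b < j := by
        rcases Nat.eq_zero_or_pos a with rfl | ha
        · exact absurd (by simp at hab; rw [hab]) hne
        · omega
      rw [(hπ _).mpr (hmin b this), mul_zero]
    · intro h; simp at h
  subst hr0
  rw [add_zero] at hr
  rw [pow_zero, one_mul] at hv0
  have hcoeq : ∀ i j, co i j = ((ω : ℤ) * t - 1) * e * ((2 * k + 1) * i - 2 * j) := by
    intro i j
    simp only [hco, ← hr]
    push_cast
    ring
  set z : ℤ := ((ω : ℤ) * t - 1) * e with hz
  have hz0 : (z : κ) ≠ 0 := by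
    rw [Ne, Int.cast_eq_zero]
    have hωt' : (2 : ℤ) ≤ ω * t := by exact_mod_cast hωt
    apply mul_ne_zero
    · omega
    · omega
  have hvk : π (v (2 * k + 2)) = 0 := by
    rw [hπ]
    have h1 : m + 1 ≤ (2 * k + 2) * ω := by nlinarith
    obtain ⟨c, hc⟩ := Nat.exists_eq_add_of_le h1
    have h2 := hv (2 * k + 2) le_rfl
    rw [hc] at h2
    refine ⟨p ^ c * g (2 * k + 2), ?_⟩
    apply mul_left_cancel₀ (pow_ne_zero m hp0)
    rw [← h2]; ring
  have hu3' : ∀ i, 3 ≤ i → π (u i) = 0 := fun i hi => (hπ _).mpr (hu3 i hi)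
  let K := FractionRing κ
  let ι : κ →+* K := algebraMap κ K
  have hι : Function.Injective ι := IsFractionRing.injective κ K
  have : CharZero K := charZero_of_injective_ringHom hι
  have hfin := rec_field k (ι (π (u 0))) (ι (π (u 1))) (ι (π (u 2))) (fun j => ι (π (v j))) ?_ ?_ ?_ ?_
  · have : π (u1 ^ 2 - 4 * h' ^ (2 * e) * u2) = 0 := by
      apply hι
      rw [hu0', hu1', hu2'] at hfin
      simp only [map_sub, map_mul, map_pow, map_ofNat, map_zero] at hfin ⊢
      linear_combination hfin
    exact (hπ _).mp this
  · intro h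
    have : π (v 0) = 0 := hι (by rw [map_zero]; exact h)
    rw [hv0] at this
    exact hw ((hπ _).mp this)
  · simp only [hvk, map_zero]
  · have h1 := hmain' 1 (by omega)
    rw [Finset.Nat.sum_antidiagonal_succ] at h1
    simp only [hcoeq, Finset.Nat.antidiagonal_zero, Finset.sum_singleton, zero_add] at h1
    push_cast at h1
    have h2 : (z : κ) * ((2 * k + 1) * π (u 1) * π (v 0) - 2 * π (u 0) * π (v 1)) = 0 := by
      linear_combination h1
    have h3 := (mul_eq_zero.mp h2).resolve_left hz0
    have h4 := congrArg ι h3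
    simp only [map_sub, map_mul, map_add, map_ofNat, map_zero, map_natCast, map_one] at h4
    linear_combination h4
  · intro J hJ
    have h1 := hmain' (J + 2) (by omega)
    rw [Finset.Nat.sum_antidiagonal_succ, Finset.Nat.sum_antidiagonal_succ, Finset.sum_eq_single (0, J)] at h1
    · simp only [hcoeq, zero_add] at h1
      have h2 : (z : κ) * ((2 * (2 * k + 1) - 2 * J) * π (u 2) * π (v J) + (2 * k + 1 - 2 * (J + 1)) * π (u 1) * π (v (J + 1)) - 2 * (J + 2) * π (u 0) * π (v (J + 2))) = 0 := by
        push_cast at h1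
        linear_combination h1
      have h3 := (mul_eq_zero.mp h2).resolve_left hz0
      have h4 := congrArg ι h3
      simp only [map_sub, map_mul, map_add, map_ofNat, map_zero, map_natCast, map_one] at h4
      linear_combination -h4
    · rintro ⟨a, b⟩ hab hne
      rw [Finset.HasAntidiagonal.mem_antidiagonal] at hab
      have : 3 ≤ a + 1 + 1 := by
        rcases Nat.eq_zero_or_pos a with rfl | ha
        · exact absurd (by simp at hab; rw [hab]) hne
        · omega
      simp only
      rw [hu3' _ this, mul_zero, zero_mul]
    · intro h; simp at h

lemma euler_comp {n : ℕ} (F : MvPolynomial (Fin n) ℂ) (m : ℕ) :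
    ∑ p, X p * pderiv p (homogeneousComponent m F) = (m : MvPolynomial (Fin n) ℂ) * homogeneousComponent m F := by
  rw [(homogeneousComponent_isHomogeneous m F).sum_X_mul_pderiv, nsmul_eq_mul]

/-- descending homogeneous components -/
noncomputable def dcomp {n : ℕ} (F : MvPolynomial (Fin n) ℂ) (d i : ℕ) : MvPolynomial (Fin n) ℂ :=
  if i ≤ d then homogeneousComponent (d - i) F else 0

lemma sum_dcomp {n : ℕ} (F : MvPolynomial (Fin n) ℂ) (d : ℕ) (hF : F.totalDegree = d) :
    ∑ i ∈ Finset.range (d + 1), dcomp F d i = F := by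
  have h1 : ∑ i ∈ Finset.range (d + 1), dcomp F d i = ∑ i ∈ Finset.range (d + 1), homogeneousComponent (d - i) F := by
    apply Finset.sum_congr rfl
    intro i hi
    rw [dcomp, if_pos (by simp at hi; omega)]
  rw [h1, Finset.sum_flip (fun i => homogeneousComponent i F), ← hF]
  exact sum_homogeneousComponent F

lemma euler_dcomp {n : ℕ} (F : MvPolynomial (Fin n) ℂ) (d i : ℕ) :
    ∑ p, X p * pderiv p (dcomp F d i) = ((d : MvPolynomial (Fin n) ℂ) - i) * dcomp F d i := by
  unfold dcomp
  split_ifs with h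
  · rw [euler_comp, Nat.cast_sub h]
  · simp

lemma term_hom {n : ℕ} (F G : MvPolynomial (Fin n) ℂ) (d N i j : ℕ) (hi : i ≤ d) (hj : j ≤ N) (q : Fin n) :
    (dcomp F d i * pderiv q (dcomp G N j)).IsHomogeneous (d + N - 1 - (i + j)) := by
  rcases Nat.lt_or_ge j N with h | h
  · have h1 : (dcomp F d i).IsHomogeneous (d - i) := by
      rw [dcomp, if_pos hi]; exact homogeneousComponent_isHomogeneous _ _
    have h2 : (pderiv q (dcomp G N j)).IsHomogeneous (N - j - 1) := by
      rw [dcomp, if_pos hj]; exact (homogeneousComponent_isHomogeneous _ _).pderiv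
    have := h1.mul h2
    rwa [show d - i + (N - j - 1) = d + N - 1 - (i + j) by omega] at this
  · have : pderiv q (dcomp G N j) = 0 := by
      rw [dcomp, if_pos hj, show N - j = 0 by omega, homogeneousComponent_zero, pderiv_C]
    rw [this, mul_zero]
    exact isHomogeneous_zero _ _ _

lemma bracket_rel {n : ℕ} (F G : MvPolynomial (Fin n) ℂ) (d N k : ℕ) (hF : F.totalDegree = d) (hG : G.totalDegree = N)
    (hd : 1 ≤ d) (hN : 2 * k + 2 ≤ N)
    (hdeg : PoissonDegLT F G ((d : ℤ) + N - 2 * k - 2)) (q : Fin n) (J : ℕ) (hJ : J ≤ 2 * k + 2) :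
    ∑ x ∈ Finset.HasAntidiagonal.antidiagonal J,
      ((d - (x.1 : MvPolynomial (Fin n) ℂ)) * dcomp F d x.1 * pderiv q (dcomp G N x.2)
        - (N - (x.2 : MvPolynomial (Fin n) ℂ)) * dcomp G N x.2 * pderiv q (dcomp F d x.1)) = 0 := by
  set T : ℕ × ℕ → MvPolynomial (Fin n) ℂ := fun x =>
      ((d - (x.1 : MvPolynomial (Fin n) ℂ)) * dcomp F d x.1 * pderiv q (dcomp G N x.2)
        - (N - (x.2 : MvPolynomial (Fin n) ℂ)) * dcomp G N x.2 * pderiv q (dcomp F d x.1)) with hT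
  have hsub : ∑ x ∈ (Finset.range (d + 1) ×ˢ Finset.range (N + 1)).filter (fun x => x.1 + x.2 = J), T x
      = ∑ x ∈ Finset.HasAntidiagonal.antidiagonal J, T x := by
    apply Finset.sum_subset
    · rintro ⟨i, j⟩ hx
      rw [Finset.mem_filter] at hx
      rw [Finset.HasAntidiagonal.mem_antidiagonal]; exact hx.2
    · rintro ⟨i, j⟩ hx hnx
      rw [Finset.HasAntidiagonal.mem_antidiagonal] at hx
      simp only [Finset.mem_filter, Finset.mem_product, Finset.mem_range, not_and] at hnx
      simp only at hx
      by_cases hi : i ≤ d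
      · have hj : ¬ j ≤ N := fun hj => hnx ⟨by omega, by omega⟩ hx
        simp [hT, dcomp, hj]
      · simp [hT, dcomp, hi]
  rw [← hsub]
  have hE : ∀ (H : MvPolynomial (Fin n) ℂ) (m : ℕ), H.totalDegree = m →
      ∑ p, X p * pderiv p H = ∑ i ∈ Finset.range (m + 1), ((m : MvPolynomial (Fin n) ℂ) - i) * dcomp H m i := by
    intro H m hm
    conv_lhs => rw [← sum_dcomp H m hm]
    simp only [map_sum, Finset.mul_sum]
    rw [Finset.sum_comm]
    exact Finset.sum_congr rfl fun i _ => euler_dcomp H m i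
  have hD : ∀ (H : MvPolynomial (Fin n) ℂ) (m : ℕ), H.totalDegree = m →
      pderiv q H = ∑ i ∈ Finset.range (m + 1), pderiv q (dcomp H m i) := by
    intro H m hm
    conv_lhs => rw [← sum_dcomp H m hm]
    rw [map_sum]
  have hW : ∑ p, X p * (pderiv p F * pderiv q G - pderiv q F * pderiv p G)
      = ∑ x ∈ Finset.range (d + 1) ×ˢ Finset.range (N + 1), T x := by
    have h1 : ∑ p, X p * (pderiv p F * pderiv q G - pderiv q F * pderiv p G)
       = (∑ p, X p * pderiv p F) * pderiv q G - pderiv q F * (∑ p, X p * pderiv p G) := by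
      rw [Finset.sum_mul, Finset.mul_sum, ← Finset.sum_sub_distrib]
      exact Finset.sum_congr rfl fun p _ => by ring
    rw [h1, hE F d hF, hE G N hG, hD F d hF, hD G N hG, Finset.sum_mul_sum, Finset.sum_mul_sum,
      ← Finset.sum_product', ← Finset.sum_product', ← Finset.sum_sub_distrib]
    exact Finset.sum_congr rfl fun x _ => by simp only [hT]; ring
  have hz : homogeneousComponent (d + N - 1 - J) (∑ p, X p * (pderiv p F * pderiv q G - pderiv q F * pderiv p G)) = 0 := by
    rw [map_sum]
    apply Finset.sum_eq_zero
    intro p _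
    rcases hdeg p q with h | h
    · rw [h]; simp
    · apply homogeneousComponent_eq_zero
      have := totalDegree_mul (X p) (pderiv p F * pderiv q G - pderiv q F * pderiv p G)
      rw [totalDegree_X] at this
      omega
  rw [hW, map_sum] at hz
  rw [Finset.sum_filter]
  refine Eq.trans ?_ hz
  apply Finset.sum_congr rfl
  rintro ⟨i, j⟩ hx
  simp only [Finset.mem_product, Finset.mem_range] at hx
  have hh : (T (i, j)).IsHomogeneous (d + N - 1 - (i + j)) := by
    have h1 := (term_hom F G d N i j (by omega) (by omega) q).C_mul ((d : ℂ) - i)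
    have h2 := (term_hom G F N d j i (by omega) (by omega) q).C_mul ((N : ℂ) - j)
    rw [show N + d - 1 - (j + i) = d + N - 1 - (i + j) by omega] at h2
    have h3 := h1.sub h2
    simp only [map_sub, map_natCast] at h3
    simpa only [hT, mul_assoc] using h3
  simp only
  by_cases hsum : i + j = d + N
  · have hT0 : T (i, j) = 0 := by
      have e1 : i = d := by omega
      have e2 : j = N := by omega
      simp [hT, e1, e2]
    rw [hT0]; simp
  · rw [homogeneousComponent_of_mem ((mem_homogeneousSubmodule _ _).mpr hh)]
    by_cases h : i + j = J
    · rw [if_pos h, if_pos (by rw [h])]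
    · rw [if_neg h, if_neg (by omega)]

lemma hom_quot {n : ℕ} (h A : MvPolynomial (Fin n) ℂ) (a b : ℕ) (hh : h.IsHomogeneous a) (hh0 : h ≠ 0)
    (hA : A.IsHomogeneous (a + b)) (hd : h ∣ A) : ∃ B, B.IsHomogeneous b ∧ A = h * B := by
  obtain ⟨Q, rfl⟩ := hd
  refine ⟨homogeneousComponent b Q, homogeneousComponent_isHomogeneous _ _, ?_⟩
  have h1 : homogeneousComponent (a + b) (h * Q) = h * Q := homogeneousComponent_eq_self hA
  rw [← h1]
  conv_lhs => rw [← sum_homogeneousComponent Q, Finset.mul_sum, map_sum]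
  have h2 : ∀ i, homogeneousComponent (a + b) (h * homogeneousComponent i Q)
      = if i = b then h * homogeneousComponent b Q else 0 := by
    intro i
    rw [homogeneousComponent_of_mem ((mem_homogeneousSubmodule _ _).mpr (hh.mul (homogeneousComponent_isHomogeneous i Q)))]
    by_cases hib : i = b
    · simp [hib]
    · rw [if_neg (by omega), if_neg hib]
  simp only [h2]
  rw [Finset.sum_ite_eq']
  split_ifs with hb
  · rfl
  · rw [homogeneousComponent_eq_zero b Q (by simp at hb; omega), mul_zero]

theorem stmt_19 {n : ℕ} (F G h : MvPolynomial (Fin n) ℂ)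
    (d₁ : ℕ) (hd₁ : 2 ≤ d₁) (d s : ℕ) (hd : d = 2 * d₁) (hs : s = d - 1)
    (k : ℕ) (hk : 1 ≤ k) (N : ℕ) (hN : N = 2 * d₁ * k + d₁) (aN : ℂ)
    (hdN : d ≤ N) (t : ℕ) (ht : 1 ≤ t) (htd : t ∣ d₁)
    (hFdeg : F.totalDegree = d) (hGdeg : G.totalDegree = N)
    (hF0 : MvPolynomial.coeff 0 F = 0) (hG0 : MvPolynomial.coeff 0 G = 0)
    (hh : h.IsHomogeneous t) (hhnp : NotProperPower h) (hsf : Squarefree h)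
    (hFd : homogeneousComponent d F = h ^ (d / t))
    (haN : aN ≠ 0) (hGN : homogeneousComponent N G = aN • h ^ (N / t))
    (hdeg : PoissonDegLT F G ((d : ℤ) + N - 2 * k - 2)) :
    ∃ Ft Fh : MvPolynomial (Fin n) ℂ,
      Ft.IsHomogeneous (d₁ - 1) ∧ Fh.IsHomogeneous (s - t - 1) ∧
      homogeneousComponent s F = h ^ (d₁ / t) * Ft ∧
      homogeneousComponent (s - 1) F = (4 : ℂ)⁻¹ • (Ft ^ 2 + h * Fh) := by
  have hh0 : h ≠ 0 := hsf.ne_zero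
  obtain ⟨e, rfl⟩ := htd
  have he : 1 ≤ e := by
    rcases e with _ | e
    · omega
    · omega
  have hdt : d / t = 2 * e := by
    rw [hd, show 2 * (t * e) = t * (2 * e) by ring]; exact Nat.mul_div_cancel_left _ (by omega)
  have hNt : N / t = e * (2 * k + 1) := by
    rw [hN, show 2 * (t * e) * k + t * e = t * (e * (2 * k + 1)) by ring]; exact Nat.mul_div_cancel_left _ (by omega)
  have het : t * e / t = e := Nat.mul_div_cancel_left _ (by omega)
  have hN' : N = e * (2 * k + 1) * t := by rw [hN]; ring
  have hd' : d = 2 * e * t := by rw [hd]; ring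
  have hte : t ≤ t * e := Nat.le_mul_of_pos_right _ he
  have hNk : 2 * k + 2 ≤ N := by rw [hN]; nlinarith
  rw [hdt] at hFd
  rw [hNt] at hGN
  rw [het]
  have hs1 : s - 1 = d - 2 := by omega
  rw [hs1]
  have hkey : ∀ p h', Prime p → h = p * h' → ¬ p ∣ h' ∧ ∀ ω u1 u2, e ≤ ω →
      p ^ ω * homogeneousComponent s F = p ^ (2 * e) * u1 →
      p ^ (2 * ω) * homogeneousComponent (d - 2) F = p ^ (2 * e) * u2 →
      p ∣ u1 ^ 2 - 4 * h' ^ (2 * e) * u2 := by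
    intro p h' hp hph
    have hph' : ¬ p ∣ h' := by
      rintro ⟨c, rfl⟩
      exact hp.not_isUnit (hsf p ⟨c, by rw [hph]; ring⟩)
    refine ⟨hph', ?_⟩
    intro ω u1 u2 hω hu1 hu2
    obtain ⟨q, hq⟩ := exists_pderiv p hp
    refine core (pderiv q) p hp hq e t k ω he hω ?_ (dcomp F d) (dcomp G N) h' (C aN * h' ^ (e * (2 * k + 1)))
      u1 u2 hph' ?_ ?_ ?_ ?_ ?_ ?_
    · have : e * t ≤ ω * t := Nat.mul_le_mul_right _ hω
      have := mul_comm e t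
      omega
    · intro hdv
      rcases hp.dvd_or_dvd hdv with h1 | h1
      · exact hp.not_isUnit (isUnit_of_dvd_unit h1 ((isUnit_iff_ne_zero.mpr haN).map C))
      · exact hph' (hp.dvd_of_dvd_pow h1)
    · rw [dcomp, if_pos (by omega), Nat.sub_zero, hFd, hph, mul_pow]
    · rw [dcomp, if_pos (by omega), Nat.sub_zero, hGN, hph, mul_pow, smul_eq_C_mul]; ring
    · rw [dcomp, if_pos (by omega), ← hs]; exact hu1
    · rw [dcomp, if_pos (by omega)]; exact hu2
    · intro J hJ
      rw [← hd', ← hN']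
      exact bracket_rel F G d N k hFdeg hGdeg (by omega) hNk hdeg q J hJ
  have hstep1 : h ^ e ∣ homogeneousComponent s F := by
    apply sqf_pow_dvd e _ h hsf
    rintro p hp ⟨h', hph⟩
    obtain ⟨hph', hk1⟩ := hkey p h' hp hph
    by_contra hnd
    have hA0 : homogeneousComponent s F ≠ 0 := by
      intro h0; rw [h0] at hnd; exact hnd (dvd_zero _)
    obtain ⟨a, ha, hna⟩ := (FiniteMultiplicity.of_prime_left hp hA0).exists_eq_pow_mul_and_not_dvd
    set v := multiplicity p (homogeneousComponent s F)
    have hve : v < e := by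
      by_contra hcon
      apply hnd
      rw [ha]
      exact (pow_dvd_pow p (by omega)).mul_right _
    obtain ⟨c, hc⟩ := Nat.exists_eq_add_of_le (show 2 * e + 1 ≤ 2 * (2 * e - v) by omega)
    have := hk1 (2 * e - v) a (p * (p ^ c * homogeneousComponent (d - 2) F)) (by omega)
      (by rw [ha, ← mul_assoc, ← pow_add, Nat.sub_add_cancel (by omega)])
      (by rw [hc]; ring)
    have h2 : p ∣ a ^ 2 := by
      have h3 : p ∣ 4 * h' ^ (2 * e) * (p * (p ^ c * homogeneousComponent (d - 2) F)) :=
        ⟨4 * h' ^ (2 * e) * (p ^ c * homogeneousComponent (d - 2) F), by ring⟩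
      exact (dvd_sub_left h3).mp this
    exact hna (hp.dvd_of_dvd_pow h2)
  have hsd : s = t * e + (t * e - 1) := by omega
  obtain ⟨Ft, hFt, hFs⟩ := hom_quot (h ^ e) _ (t * e) (t * e - 1) (hh.pow e) (pow_ne_zero _ hh0)
    (hsd ▸ homogeneousComponent_isHomogeneous s F) hstep1
  have hstep2 : h ∣ 4 * homogeneousComponent (d - 2) F - Ft ^ 2 := by
    have := sqf_pow_dvd 1 (4 * homogeneousComponent (d - 2) F - Ft ^ 2) h hsf ?_
    · rwa [pow_one] at this
    rintro p hp ⟨h', hph⟩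
    obtain ⟨hph', hk1⟩ := hkey p h' hp hph
    rw [pow_one]
    have := hk1 e (h' ^ e * Ft) (homogeneousComponent (d - 2) F) le_rfl
      (by rw [hFs, hph]; ring) rfl
    have h2 : p ∣ h' ^ (2 * e) * (4 * homogeneousComponent (d - 2) F - Ft ^ 2) := by
      rw [← dvd_neg]
      convert this using 1
      ring
    exact (hp.dvd_or_dvd h2).resolve_left fun h3 => hph' (hp.dvd_of_dvd_pow h3)
  have hhom : (4 * homogeneousComponent (d - 2) F - Ft ^ 2).IsHomogeneous (t + (s - t - 1)) := by
    rw [show t + (s - t - 1) = d - 2 by omega]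
    apply IsHomogeneous.sub
    · have := (homogeneousComponent_isHomogeneous (d - 2) F).C_mul (4 : ℂ)
      simpa only [map_ofNat] using this
    · have := hFt.pow 2
      rwa [show (t * e - 1) * 2 = d - 2 by omega] at this
  obtain ⟨Fh, hFh, hq⟩ := hom_quot h _ t (s - t - 1) hh hh0 hhom hstep2
  refine ⟨Ft, Fh, hFt, hFh, hFs, ?_⟩
  rw [← hq, add_sub_cancel, show (4 : MvPolynomial (Fin n) ℂ) = C 4 from (map_ofNat C 4).symm, ← smul_eq_C_mul, smul_smul]
  norm_num
end
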